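/- For a word w = w_1 w_2 ⋯ w_l, let ŵ = w_2 ⋯ w_l be the word with the first letter deleted, and for a (shifted or straight-shape) standard tableau T let ΔT denote the result of deleting the smallest entry of T and performing jeu de taquin to slide the empty box out (without refilling it), with all remaining entries decreased by 1. Then Q(ŵ) = ΔQ(w) and Q'(ŵ) = ΔQ'(w), where Q and Q' denote the RSK and shifted mixed insertion recording tableaux respectively. -/

import Mathlib

/-! ### Tableau machinery: fillings as functions `ℕ × ℕ → ℕ` (entry `0` = empty/absent cell) -/

/-- One jeu de taquin slide: starting from an empty box at position `c`, repeatedly swap the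
empty box with the smaller of the entries directly to its right and directly below it
(`0` denotes an empty/absent cell), until neither exists.  Returns the resulting filling
together with the final position of the empty box; `fuel` bounds the number of steps. -/
def jdtSlide : ℕ → ((ℕ × ℕ) → ℕ) → (ℕ × ℕ) → (((ℕ × ℕ) → ℕ) × (ℕ × ℕ))
  | 0, f, c => (f, c)
  | fuel+1, f, c =>
    let a := c.1
    let b := c.2
    let r := f (a, b+1)
    let d := f (a+1, b)
    if r = 0 ∧ d = 0 then (f, c)
    else if d = 0 ∨ (r ≠ 0 ∧ r < d) then
      jdtSlide fuel (Function.update (Function.update f (a, b+1) 0) (a, b) r) (a, b+1)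
    else
      jdtSlide fuel (Function.update (Function.update f (a+1, b) 0) (a, b) d) (a+1, b)

/-- Jeu de taquin promotion of a standard filling with `N` boxes: delete the entry `1`
(in the upper left corner `(0,0)`), decrease every other entry by `1`, slide the empty box
by jeu de taquin, and fill the final empty box with `N`. -/
def promote (N : ℕ) (f : (ℕ × ℕ) → ℕ) : (ℕ × ℕ) → ℕ :=
  let s := jdtSlide N (fun c => f c - 1) (0, 0)
  Function.update s.1 s.2 N

/-- The cells of the (straight-shape) Young diagram of a partition `lam`:
row `a` consists of the cells `(a, b)` with `b < lam a`. -/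
def strCell (lam : List ℕ) (c : ℕ × ℕ) : Prop := c.2 < lam.getD c.1 0

/-- The cells of the shifted Young diagram of a strict partition `lam`:
row `a` consists of the cells `(a, b)` with `a ≤ b < a + lam a`. -/
def shiftCell (lam : List ℕ) (c : ℕ × ℕ) : Prop :=
  c.1 ≤ c.2 ∧ c.2 < c.1 + lam.getD c.1 0

/-- `IsStdFilling cells N f` : `f` is a standard tableau on the cell set `cells` with
entries `1, …, N`: it vanishes off `cells`, restricts to a bijection `cells → {1, …, N}`,
and is strictly increasing along rows and columns. -/
def IsStdFilling (cells : ℕ × ℕ → Prop) (N : ℕ) (f : (ℕ × ℕ) → ℕ) : Prop :=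
  (∀ c, ¬ cells c → f c = 0) ∧
  (∀ c, cells c → 1 ≤ f c ∧ f c ≤ N) ∧
  (∀ c c', cells c → cells c' → f c = f c' → c = c') ∧
  (∀ v, 1 ≤ v → v ≤ N → ∃ c, cells c ∧ f c = v) ∧
  (∀ a b, cells (a, b) → cells (a, b+1) → f (a, b) < f (a, b+1)) ∧
  (∀ a b, cells (a, b) → cells (a+1, b) → f (a, b) < f (a+1, b))

/-- The rectangular partition with `b` rows and `n` columns. -/
def rectShape (b n : ℕ) : List ℕ := List.replicate b n

/-- The square partition with `n` rows and `n` columns. -/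
def sqShape (n : ℕ) : List ℕ := List.replicate n n

/-- The doubled staircase strict partition `(2n-1, 2n-3, …, 1)`. -/
def dblStair (n : ℕ) : List ℕ := (List.range n).map (fun i => 2*n - 1 - 2*i)

/-- The index of the row containing the entry `v` of a filling
(rows numbered `0, 1, 2, …` from the top). -/
noncomputable def rowOf (f : (ℕ × ℕ) → ℕ) (v : ℕ) : ℕ := sInf {a | ∃ b, f (a, b) = v}

/-! ### Insertion machinery: tableaux as lists of rows of naturals -/

/-- Set position `j` of the list `l` to `v`, padding with `0`s if necessary. -/
def padSet (l : List ℕ) (j v : ℕ) : List ℕ :=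
  if j < l.length then l.set j v else l ++ List.replicate (j - l.length) 0 ++ [v]

/-- Set the box in row `r`, (row-relative) position `j`, of the tableau `T` to `v`,
adding new rows if necessary. -/
def setBox (T : List (List ℕ)) (r j v : ℕ) : List (List ℕ) :=
  let T' := if r < T.length then T else T ++ List.replicate (r + 1 - T.length) ([] : List ℕ)
  T'.set r (padSet (T'.getD r []) j v)

/-- The number of boxes of a tableau. -/
def tsize (T : List (List ℕ)) : ℕ := (T.map List.length).sum

/-- RSK row insertion of a letter `x` into a tableau: `x` bumps the leftmost entry of the
first row that is strictly greater than `x`; the bumped entry is inserted into the next row,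
and so on; a letter bumping nothing is placed at the end of the row. -/
def rskInsert (x : ℕ) : List (List ℕ) → List (List ℕ)
  | [] => [[x]]
  | row :: rest =>
    match row.findIdx? (fun z => decide (x < z)) with
    | none => (row ++ [x]) :: rest
    | some j => row.set j x :: rskInsert (row.getD j 0) rest

/-- The (unique) cell where the shapes of the tableaux `T` and `T'` differ,
when `T'` is obtained from `T` by one insertion. -/
def newCell (T T' : List (List ℕ)) : ℕ × ℕ :=
  let r := (List.range T'.length).findIdx
    (fun r => decide ((T.getD r []).length ≠ (T'.getD r []).length))
  (r, (T.getD r []).length)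

/-- The RSK insertion tableau `P(w)` and recording tableau `Q(w)` of a word `w`. -/
def rskPQ (w : List ℕ) : List (List ℕ) × List (List ℕ) :=
  w.foldl
    (fun PQ x =>
      let P' := rskInsert x PQ.1
      let c := newCell PQ.1 P'
      (P', setBox PQ.2 c.1 c.2 (tsize PQ.2 + 1)))
    ([], [])

/-- The RSK insertion tableau `P(w)` of the word `w`. -/
def rskP (w : List ℕ) : List (List ℕ) := (rskPQ w).1

/-- The RSK recording tableau `Q(w)` of the word `w`. -/
def rskQ (w : List ℕ) : List (List ℕ) := (rskPQ w).2

/-! Shifted mixed insertion (Haiman; semistandard version of Serrano).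

A shifted tableau is stored as a list of rows, row `r` occupying the (absolute) columns
`r, r+1, …`.  Entries are encoded so that primed letters can be handled: the unprimed
letter `k` is stored as `2k` and the primed letter `k'` is stored as `2k - 1`; this
encoding is order-preserving for the alphabet `1' < 1 < 2' < 2 < ⋯`. -/

/-- The entry of a shifted tableau `T` in row `r` and (absolute) column `c`, with `0`
meaning that there is no such box. -/
def sEntry (T : List (List ℕ)) (r c : ℕ) : ℕ := (T.getD r []).getD (c - r) 0

/-- One step of shifted mixed insertion, with `fuel` bounding the bumping chain.
If `isRow = true`, the (unprimed) value `v` is inserted into row `i`, bumping the leftmost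
entry strictly greater than `v`; if `isRow = false`, the (primed) value `v` is inserted into
column `i`, bumping the topmost entry strictly greater than `v`; a value bumping nothing is
placed at the end of the row resp. the bottom of the column, ending the insertion.
An entry bumped from the main diagonal becomes primed.  A bumped unprimed entry is inserted
into the next row; a bumped primed entry is inserted into the next column.
Returns the new tableau and the cell `(row, column)` where the insertion terminated. -/
def mixedIns : ℕ → List (List ℕ) → Bool → ℕ → ℕ → List (List ℕ) × (ℕ × ℕ)
  | 0, T, _, _, _ => (T, (0, 0))
  | fuel+1, T, true, r, v =>
    let row := T.getD r []
    match row.findIdx? (fun z => decide (v < z)) with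
    | none => (setBox T r row.length v, (r, r + row.length))
    | some j =>
      let z := row.getD j 0
      let T' := T.set r (row.set j v)
      let z' := if j = 0 ∧ z % 2 = 0 then z - 1 else z
      if z' % 2 = 0 then mixedIns fuel T' true (r+1) z'
      else mixedIns fuel T' false (r + j + 1) z'
  | fuel+1, T, false, c, v =>
    match (List.range (c+1)).find? (fun r =>
        decide (c - r < (T.getD r []).length) && decide (v < sEntry T r c)) with
    | some r =>
      let z := sEntry T r c
      let T' := setBox T r (c - r) v
      let z' := if r = c ∧ z % 2 = 0 then z - 1 else z
      if z' % 2 = 0 then mixedIns fuel T' true (r+1) z'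
      else mixedIns fuel T' false (c+1) z'
    | none =>
      let r := (List.range (c+1)).findIdx (fun r => decide ((T.getD r []).length ≤ c - r))
      (setBox T r (c - r) v, (r, c))

/-- Shifted mixed insertion of the letter `x` into the shifted tableau `T`:
the new insertion tableau together with the new cell. -/
def mixedInsLetter (T : List (List ℕ)) (x : ℕ) : List (List ℕ) × (ℕ × ℕ) :=
  mixedIns (tsize T + 2) T true 0 (2 * x)

/-- The shifted mixed insertion tableau `P'(w)` (with primed entries encoded as above) and
the standard shifted recording tableau `Q'(w)` of a word `w`. -/
def mixedPQ (w : List ℕ) : List (List ℕ) × List (List ℕ) :=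
  w.foldl
    (fun PQ x =>
      let s := mixedInsLetter PQ.1 x
      (s.1, setBox PQ.2 s.2.1 (s.2.2 - s.2.1) (tsize PQ.2 + 1)))
    ([], [])

/-- The shifted mixed insertion tableau `P'(w)` of the word `w`. -/
def mixedP (w : List ℕ) : List (List ℕ) := (mixedPQ w).1

/-- The shifted mixed insertion recording tableau `Q'(w)` of the word `w`. -/
def mixedQ (w : List ℕ) : List (List ℕ) := (mixedPQ w).2

/-- View a straight-shape tableau (list of rows) as a filling `ℕ × ℕ → ℕ`. -/
def toFunStraight (T : List (List ℕ)) : (ℕ × ℕ) → ℕ := fun c => (T.getD c.1 []).getD c.2 0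

/-- View a shifted tableau (list of rows, row `r` starting in column `r`) as a filling
`ℕ × ℕ → ℕ`. -/
def toFunShifted (T : List (List ℕ)) : (ℕ × ℕ) → ℕ :=
  fun c => if c.1 ≤ c.2 then (T.getD c.1 []).getD (c.2 - c.1) 0 else 0

/-- `Δ T`: delete the smallest entry of the standard filling `T` (the entry `1`, in the
upper left corner), decrease all remaining entries by `1`, and slide the empty box out by
jeu de taquin, without refilling it.  (`N` bounds the length of the slide path.) -/
def deltaOp (N : ℕ) (f : (ℕ × ℕ) → ℕ) : (ℕ × ℕ) → ℕ :=
  (jdtSlide N (fun c => f c - 1) (0, 0)).1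

namespace RT

/-- validity of a cell (all cells, or weakly above the diagonal in the shifted case) -/
def V (sh : Bool) (r s : ℕ) : Prop := sh = true → r ≤ s

structure Low (sh : Bool) (S : List (ℕ × ℕ)) : Prop where
  valid : ∀ r s, (r, s) ∈ S → V sh r s
  left : ∀ r s, (r, s + 1) ∈ S → V sh r s → (r, s) ∈ S
  up : ∀ r s, (r + 1, s) ∈ S → (r, s) ∈ S

theorem Low.up' {sh S} (h : Low sh S) {r s r' : ℕ} (hm : (r, s) ∈ S) (hr : r' ≤ r) :
    (r', s) ∈ S := by
  induction r, hr using Nat.le_induction with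
  | base => exact hm
  | succ n hn ih => exact ih (h.up _ _ hm)

theorem Low.left' {sh S} (h : Low sh S) {r s s' : ℕ} (hm : (r, s) ∈ S) (hs : s' ≤ s)
    (hv : V sh r s') : (r, s') ∈ S := by
  induction s, hs using Nat.le_induction with
  | base => exact hm
  | succ n hn ih => exact ih (h.left _ _ hm (fun hh => (hv hh).trans hn))

theorem Low.mem {sh S} (h : Low sh S) {r s r' s' : ℕ} (hm : (r, s) ∈ S) (hr : r' ≤ r)
    (hs : s' ≤ s) (hv : V sh r' s') : (r', s') ∈ S :=
  h.left' (h.up' hm hr) hs hv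

theorem Low.congr {sh S S'} (h : Low sh S) (hh : ∀ x, x ∈ S' ↔ x ∈ S) : Low sh S' where
  valid r s hm := h.valid r s ((hh _).1 hm)
  left r s hm hv := (hh _).2 (h.left r s ((hh _).1 hm) hv)
  up r s hm := (hh _).2 (h.up r s ((hh _).1 hm))

theorem Low.union {sh S S' T} (h : Low sh S) (h' : Low sh S')
    (hh : ∀ x, x ∈ T ↔ x ∈ S ∨ x ∈ S') : Low sh T where
  valid r s hm := ((hh _).1 hm).elim (h.valid r s) (h'.valid r s)
  left r s hm hv := (hh _).2 (((hh _).1 hm).imp (fun k => h.left r s k hv)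
    (fun k => h'.left r s k hv))
  up r s hm := (hh _).2 (((hh _).1 hm).imp (h.up r s) (h'.up r s))

def Good (sh : Bool) : List (ℕ × ℕ) → Prop
  | [] => True
  | f :: fs => Good sh fs ∧ f ∉ fs ∧ Low sh (f :: fs)

theorem Good.low {sh S} (h : Good sh S) : Low sh S := by
  cases S with
  | nil => exact ⟨by simp, by simp, by simp⟩
  | cons f fs => exact h.2.2

def RowEnd (sh : Bool) (S : List (ℕ × ℕ)) (r s : ℕ) : Prop :=
  V sh r s ∧ (r, s) ∉ S ∧ ∀ s' < s, V sh r s' → (r, s') ∈ S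

def ColEnd (sh : Bool) (S : List (ℕ × ℕ)) (r s : ℕ) : Prop :=
  V sh r s ∧ (r, s) ∉ S ∧ ∀ r' < r, (r', s) ∈ S

theorem RowEnd.uniq {sh S r s s'} (h : RowEnd sh S r s) (h' : RowEnd sh S r s') : s = s' := by
  rcases lt_trichotomy s s' with hl | hl | hl
  · exact absurd (h'.2.2 s hl h.1) h.2.1
  · exact hl
  · exact absurd (h.2.2 s' hl h'.1) h'.2.1

theorem ColEnd.uniq {sh S r s r'} (h : ColEnd sh S r s) (h' : ColEnd sh S r' s) : r = r' := by
  rcases lt_trichotomy r r' with hl | hl | hl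
  · exact absurd (h'.2.2 r hl) h.2.1
  · exact hl
  · exact absurd (h.2.2 r' hl) h'.2.1

theorem RowEnd.congr {sh S S' r s} (h : RowEnd sh S r s) (hh : ∀ x, x ∈ S' ↔ x ∈ S) :
    RowEnd sh S' r s :=
  ⟨h.1, fun k => h.2.1 ((hh _).1 k), fun s' hs hv => (hh _).2 (h.2.2 s' hs hv)⟩

theorem ColEnd.congr {sh S S' r s} (h : ColEnd sh S r s) (hh : ∀ x, x ∈ S' ↔ x ∈ S) :
    ColEnd sh S' r s :=
  ⟨h.1, fun k => h.2.1 ((hh _).1 k), fun s' hs => (hh _).2 (h.2.2 s' hs)⟩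

/-- a corner that can be added is the end of its row and of its column -/
theorem Low.rowEnd {sh S r s} (h : Low sh ((r, s) :: S)) (hn : (r, s) ∉ S) : RowEnd sh S r s := by
  refine ⟨h.valid r s (by simp), hn, fun s' hs hv => ?_⟩
  have := h.left' (r := r) (s := s) (by simp) hs.le hv
  simp only [List.mem_cons, Prod.mk.injEq, true_and] at this
  exact this.resolve_left (by omega)

theorem Low.colEnd {sh S r s} (h : Low sh ((r, s) :: S)) (hn : (r, s) ∉ S) : ColEnd sh S r s := by
  refine ⟨h.valid r s (by simp), hn, fun r' hr => ?_⟩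
  have := h.up' (r := r) (s := s) (by simp) hr.le
  simp only [List.mem_cons, Prod.mk.injEq, and_true] at this
  exact this.resolve_left (by omega)

theorem Low.cons_of {sh S r s} (h : Low sh S) (h1 : RowEnd sh S r s) (h2 : ColEnd sh S r s) :
    Low sh ((r, s) :: S) where
  valid a b hm := by
    simp only [List.mem_cons, Prod.mk.injEq] at hm
    rcases hm with ⟨rfl, rfl⟩ | hm
    · exact h1.1
    · exact h.valid _ _ hm
  left a b hm hv := by
    simp only [List.mem_cons, Prod.mk.injEq] at hm
    rcases hm with ⟨rfl, rfl⟩ | hm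
    · exact List.mem_cons_of_mem _ (h1.2.2 _ (by omega) hv)
    · exact List.mem_cons_of_mem _ (h.left _ _ hm hv)
  up a b hm := by
    simp only [List.mem_cons, Prod.mk.injEq] at hm
    rcases hm with ⟨rfl, rfl⟩ | hm
    · exact List.mem_cons_of_mem _ (h2.2.2 _ (by omega))
    · exact List.mem_cons_of_mem _ (h.up _ _ hm)

/-- after a row bump, the new end of the next row is a corner -/
theorem rowBump_corner {sh S r s s'} (hS : Low sh S) (hn : (r, s) ∉ S) (h : Low sh ((r, s) :: S))
    (hd : ¬ (sh = true ∧ r = s)) (he : RowEnd sh ((r, s) :: S) (r + 1) s') :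
    s' ≤ s ∧ Low sh ((r + 1, s') :: (r, s) :: S) := by
  have hv : V sh r s := h.valid r s (by simp)
  have hle : s' ≤ s := by
    by_contra hlt
    have := he.2.2 s (by omega) (fun hh => by have := hv hh; have : r ≠ s := fun h => hd ⟨hh, h⟩; omega)
    simp only [List.mem_cons, Prod.mk.injEq] at this
    rcases this with h1 | h1
    · omega
    · exact hn (hS.up _ _ h1)
  refine ⟨hle, h.cons_of he ⟨he.1, he.2.1, fun r' hr => ?_⟩⟩
  exact h.mem (r := r) (s := s) (by simp) (by omega) hle (fun hh => by have := he.1 hh; omega)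

theorem colBump_corner {sh S r s r'} (hS : Low sh S) (hn : (r, s) ∉ S) (h : Low sh ((r, s) :: S))
    (he : ColEnd sh ((r, s) :: S) r' (s + 1)) :
    r' ≤ r ∧ Low sh ((r', s + 1) :: (r, s) :: S) := by
  have hv : V sh r s := h.valid r s (by simp)
  have hle : r' ≤ r := by
    by_contra hlt
    have := he.2.2 r (by omega)
    simp only [List.mem_cons, Prod.mk.injEq] at this
    rcases this with h1 | h1
    · omega
    · exact hn (hS.left _ _ h1 hv)
  refine ⟨hle, h.cons_of ⟨he.1, he.2.1, fun s' hs hv' => ?_⟩ he⟩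
  exact h.mem (r := r) (s := s) (by simp) hle (by omega) hv'

inductive Bump (sh : Bool) : ℕ → List (ℕ × ℕ) → List (ℕ × ℕ) → ℕ → ℕ → Bool → Prop
  | start {fs s} : RowEnd sh fs 0 s → Bump sh 0 fs ((0, s) :: fs) 0 s false
  | same {k fs gs r s t f} : Bump sh k fs gs r s t → f ≠ (r, s) →
      Bump sh (k + 1) (f :: fs) (f :: gs) r s t
  | row {k fs gs r s s'} : Bump sh k fs gs r s false → ¬ (sh = true ∧ r = s) →
      RowEnd sh ((r, s) :: fs) (r + 1) s' →
      Bump sh (k + 1) ((r, s) :: fs) ((r + 1, s') :: gs) (r + 1) s' false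
  | col {k fs gs r s t r'} : Bump sh k fs gs r s t → sh = true → (t = true ∨ r = s) →
      ColEnd sh ((r, s) :: fs) r' (s + 1) →
      Bump sh (k + 1) ((r, s) :: fs) ((r', s + 1) :: gs) r' (s + 1) true

theorem Bump.facts {sh k fs gs r s t} (h : Bump sh k fs gs r s t) (hG : Good sh fs) :
    Good sh gs ∧ (r, s) ∉ fs ∧ Low sh ((r, s) :: fs) ∧ (∀ x, x ∈ gs ↔ x = (r, s) ∨ x ∈ fs) ∧
    (sh = false → t = false) := by
  induction h with
  | @start fs s h =>
    have hL : Low sh ((0, s) :: fs) := hG.low.cons_of h ⟨h.1, h.2.1, fun r' hr => by omega⟩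
    exact ⟨⟨hG, h.2.1, hL⟩, h.2.1, hL, by simp, by simp⟩
  | @same k fs gs r s t f hb hne ih =>
    obtain ⟨i1, i2, i3, i4, i5⟩ := ih hG.1
    have hL : Low sh ((r, s) :: f :: fs) := i3.union hG.2.2 (by intro x; simp only [List.mem_cons]; tauto)
    refine ⟨⟨i1, ?_, hL.congr ?_⟩, ?_, hL, ?_, i5⟩
    · rw [i4]; have := hG.2.1; tauto
    · intro x; simp only [List.mem_cons, i4]; tauto
    · simp only [List.mem_cons]; tauto
    · intro x; simp only [List.mem_cons, i4]; tauto
  | @row k fs gs r s s' hb hd he ih =>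
    obtain ⟨i1, i2, i3, i4, i5⟩ := ih hG.1
    have hL := (rowBump_corner hG.1.low i2 i3 hd he).2
    refine ⟨⟨i1, ?_, hL.congr ?_⟩, he.2.1, hL, ?_, i5⟩
    · rw [i4]; have := he.2.1; simpa using this
    · intro x; simp only [List.mem_cons, i4]
    · intro x; simp only [List.mem_cons, i4]
  | @col k fs gs r s t r' hb hsh ht he ih =>
    obtain ⟨i1, i2, i3, i4, i5⟩ := ih hG.1
    have hL := (colBump_corner hG.1.low i2 i3 he).2
    refine ⟨⟨i1, ?_, hL.congr ?_⟩, he.2.1, hL, ?_, by simp [hsh]⟩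
    · rw [i4]; have := he.2.1; simpa using this
    · intro x; simp only [List.mem_cons, i4]
    · intro x; simp only [List.mem_cons, i4]

/-- The jeu de taquin relation between recording sequences. -/
inductive Jdt : List (ℕ × ℕ) → List (ℕ × ℕ) → ℕ → ℕ → Prop
  | nil : Jdt [] [(0, 0)] 0 0
  | same {fs gs r s f} : Jdt fs gs r s → f ≠ (r, s) → f ≠ (r, s + 1) → f ≠ (r + 1, s) →
      Jdt (f :: fs) (f :: gs) r s
  | slideR {fs gs r s} : Jdt fs gs r s → Jdt ((r, s) :: fs) ((r, s + 1) :: gs) r (s + 1)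
  | slideD {fs gs r s} : Jdt fs gs r s → Jdt ((r, s) :: fs) ((r + 1, s) :: gs) (r + 1) s

theorem Jdt.facts {sh fs gs r s} (h : Jdt fs gs r s) (hg : Good sh gs) :
    (r, s) ∉ fs ∧ (∀ x, x ∈ gs ↔ x = (r, s) ∨ x ∈ fs) := by
  induction h with
  | nil => simp
  | @same fs gs r s f h h1 h2 h3 ih =>
    obtain ⟨i1, i2⟩ := ih hg.1
    refine ⟨?_, ?_⟩
    · simp only [List.mem_cons]; tauto
    · intro x; simp only [List.mem_cons, i2]; tauto
  | @slideR fs gs r s h ih =>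
    obtain ⟨i1, i2⟩ := ih hg.1
    have := hg.2.1
    rw [i2] at this
    refine ⟨?_, ?_⟩
    · simp only [List.mem_cons]; tauto
    · intro x; simp only [List.mem_cons, i2]
  | @slideD fs gs r s h ih =>
    obtain ⟨i1, i2⟩ := ih hg.1
    have := hg.2.1
    rw [i2] at this
    refine ⟨?_, ?_⟩
    · simp only [List.mem_cons]; tauto
    · intro x; simp only [List.mem_cons, i2]

end RT

namespace RT

inductive St (sh : Bool) : ℕ → ℕ → ℕ → ℕ → Bool → ℕ → ℕ → Bool → ℕ → ℕ → Prop
  | A {cr cs er es t} : ¬ (er = cr ∧ es = cs) → St sh cr cs er es t er es t cr cs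
  | E {cr cs dr} : dr ≤ cr → St sh cr cs cr cs false dr (cs + 1) false dr (cs + 1)
  | F {cr cs ds t u} : sh = true → (t = true ∨ cr = cs) → (u = true ∨ cr + 1 = ds) → ds ≤ cs →
      St sh cr cs cr cs t (cr + 1) ds u (cr + 1) ds

inductive BStep (sh : Bool) (S : List (ℕ × ℕ)) :
    ℕ → ℕ → ℕ → ℕ → Bool → ℕ → ℕ → ℕ → ℕ → Bool → Prop
  | same {a b r s t} : ¬ (a = r ∧ b = s) → BStep sh S a b r s t a b r s t
  | row {r s s'} : ¬ (sh = true ∧ r = s) → RowEnd sh ((r, s) :: S) (r + 1) s' →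
      BStep sh S r s r s false (r + 1) s' (r + 1) s' false
  | col {r s t r'} : sh = true → (t = true ∨ r = s) → ColEnd sh ((r, s) :: S) r' (s + 1) →
      BStep sh S r s r s t r' (s + 1) r' (s + 1) true

inductive JStep : ℕ → ℕ → ℕ → ℕ → ℕ → ℕ → ℕ → ℕ → Prop
  | same {r s a b} : ¬ (a = r ∧ b = s) → ¬ (a = r ∧ b = s + 1) → ¬ (a = r + 1 ∧ b = s) →
      JStep r s a b a b r s
  | slideR {r s} : JStep r s r s r (s + 1) r (s + 1)
  | slideD {r s} : JStep r s r s (r + 1) s (r + 1) s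

theorem St.step {sh fs gs cr cs er es t dr ds u Cr Cs a b a2 b2 cr' cs' p q er' es' t' p2 q2 dr' ds' u'}
    (hfs : Low sh fs) (hgs : Low sh gs) (hc : (cr, cs) ∉ fs)
    (hm : ∀ x, x ∈ gs ↔ x = (cr, cs) ∨ x ∈ fs)
    (he : (er, es) ∉ fs) (heL : Low sh ((er, es) :: fs))
    (hd : (dr, ds) ∉ gs) (hdL : Low sh ((dr, ds) :: gs))
    (hf : (a, b) ∉ fs) (hfL : Low sh ((a, b) :: fs))
    (hg : (a2, b2) ∉ gs) (hgL : Low sh ((a2, b2) :: gs))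
    (hSt : St sh cr cs er es t dr ds u Cr Cs) (hJ : JStep cr cs a b a2 b2 cr' cs')
    (hB : BStep sh fs a b er es t p q er' es' t') (hB2 : BStep sh gs a2 b2 dr ds u p2 q2 dr' ds' u') :
    ∃ Cr' Cs', JStep Cr Cs p q p2 q2 Cr' Cs' ∧ St sh cr' cs' er' es' t' dr' ds' u' Cr' Cs' := by
  have hm' : ∀ r s, (r, s) ∈ gs ↔ (r = cr ∧ s = cs) ∨ (r, s) ∈ fs := by
    intro r s; rw [hm]; simp
  have sub : ∀ x y, x ∈ y :: fs → x ∈ y :: gs := by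
    intro x y h; simp only [List.mem_cons, hm] at h ⊢; tauto
  have sub2 : ∀ x y, x ∈ (cr, cs) :: fs → x ∈ y :: gs := by
    intro x y h; simp only [List.mem_cons, hm] at h ⊢; tauto
  have nsub : ∀ r s y, (r, s) ∉ y :: fs → ¬ (r = cr ∧ s = cs) → (r, s) ∉ y :: gs := by
    intro r s y h h'; simp only [List.mem_cons, hm, Prod.mk.injEq] at h ⊢; tauto
  have nsub2 : ∀ r s r' s', (r, s) ∉ (cr, cs) :: fs → ¬ (r = r' ∧ s = s') →
      (r, s) ∉ (r', s') :: gs := by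
    intro r s r' s' h h'; simp only [List.mem_cons, hm, Prod.mk.injEq] at h ⊢; tauto
  have ncons : ∀ S : List (ℕ × ℕ), ∀ r s r' s', (r, s) ∉ S → ¬ (r = r' ∧ s = s') →
      (r, s) ∉ (r', s') :: S := by
    intro S r s r' s' h h'; simp only [List.mem_cons, Prod.mk.injEq]; tauto
  have hcv : V sh cr cs := hgs.valid _ _ ((hm _).2 (Or.inl rfl))
  have hev := heL.valid er es (by simp)
  have hdv := hdL.valid dr ds (by simp)
  have hev1 := (heL.rowEnd he).2.2
  have hev2 := (heL.colEnd he).2.2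
  have hdv1 := (hdL.rowEnd hd).2.2
  have hdv2 := (hdL.colEnd hd).2.2
  have hfv := hfL.valid a b (by simp)
  have hgv := hgL.valid a2 b2 (by simp)
  have hfv1 := (hfL.rowEnd hf).2.2
  have hfv2 := (hfL.colEnd hf).2.2
  have hgv1 := (hgL.rowEnd hg).2.2
  have hgv2 := (hgL.colEnd hg).2.2
  cases hSt with
  | A hne =>
    cases hJ with
    | same h1 h2 h3 =>
      cases hB with
      | same h4 =>
        cases hB2 with
        | same h5 => exact ⟨_, _, .same h1 h2 h3, .A hne⟩
        | row h5 h6 => exact absurd ⟨rfl, rfl⟩ h4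
        | col h5 h6 h7 => exact absurd ⟨rfl, rfl⟩ h4
      | row h4 h5 =>
        have k1 := rowBump_corner hfs he heL h4 h5
        cases hB2 with
        | same h => exact absurd ⟨rfl, rfl⟩ h
        | col h6 h7 h8 => exact absurd ⟨h6, by simpa using h7⟩ h4
        | row h6 h7 =>
          by_cases hx : er + 1 = cr ∧ q = cs
          · obtain ⟨rfl, rfl⟩ := hx
            have hn : (er + 1, q + 1) ∉ fs := fun hh => hc (hfs.left _ _ hh hcv)
            have : q + 1 = q2 := by
              refine RowEnd.uniq (S := (er, es) :: gs) ⟨fun hh => (hcv hh).trans (by omega), ?_, ?_⟩ h7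
              · refine ncons _ _ _ _ _ (fun hh => ?_) (by omega)
                rcases (hm' _ _).1 hh with hh | hh
                · omega
                · exact hn hh
              · intro s' hs' hv
                rcases Nat.lt_succ_iff_lt_or_eq.1 hs' with hl | rfl
                · exact sub _ _ (h5.2.2 s' hl hv)
                · simp [hm]
            subst this
            exact ⟨_, _, .slideR, .E le_rfl⟩
          · have : q = q2 := by
              refine RowEnd.uniq (S := (er, es) :: gs) ⟨h5.1, ?_, ?_⟩ h7
              · exact nsub _ _ _ h5.2.1 hx
              · intro s' hs' hv
                exact sub _ _ (h5.2.2 s' hs' hv)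
            subst this
            refine ⟨_, _, .same hx ?_ ?_, .A hx⟩
            · rintro ⟨rfl, rfl⟩
              have := h5.2.2 cs (by omega) hcv
              simp only [List.mem_cons, Prod.mk.injEq] at this
              rcases this with h | h
              · omega
              · exact hc h
            · rintro ⟨hh, rfl⟩
              obtain rfl : er = cr := by omega
              have hcv' := k1.2.up er q (by simp)
              simp only [List.mem_cons, Prod.mk.injEq] at hcv'
              rcases hcv' with h | h | h
              · omega
              · omega
              · exact hc h
      | col h4 h5 h6 =>
        have k1 := colBump_corner hfs he heL h6
        cases hB2 with
        | same h => exact absurd ⟨rfl, rfl⟩ h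
        | row h7 h8 => exact absurd ⟨h4, by simpa using h5⟩ h7
        | col h7 h8 h9 =>
          by_cases hx : p = cr ∧ es + 1 = cs
          · obtain ⟨rfl, rfl⟩ := hx
            have hn : (p + 1, es + 1) ∉ fs := fun hh => hc (hfs.up _ _ hh)
            have : p + 1 = p2 := by
              refine ColEnd.uniq (S := (er, es) :: gs) ⟨fun hh => ?_, ?_, ?_⟩ h9
              · have := hev hh; omega
              · refine ncons _ _ _ _ _ (fun hh => ?_) (by omega)
                rcases (hm' _ _).1 hh with hh | hh
                · omega
                · exact hn hh
              · intro r' hr'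
                rcases Nat.lt_succ_iff_lt_or_eq.1 hr' with hl | rfl
                · exact sub _ _ (h6.2.2 r' hl)
                · simp [hm]
            subst this
            exact ⟨_, _, .slideD, .F h4 (Or.inl rfl) (Or.inl rfl) le_rfl⟩
          · have : p = p2 := by
              refine ColEnd.uniq (S := (er, es) :: gs) ⟨h6.1, ?_, ?_⟩ h9
              · exact nsub _ _ _ h6.2.1 hx
              · intro r' hr'
                exact sub _ _ (h6.2.2 r' hr')
            subst this
            refine ⟨_, _, .same hx ?_ ?_, .A hx⟩
            · rintro ⟨rfl, hh⟩
              obtain rfl : es = cs := by omega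
              have hcv' := k1.2.left p es (by simp) hcv
              simp only [List.mem_cons, Prod.mk.injEq] at hcv'
              rcases hcv' with h | h | h
              · omega
              · omega
              · exact hc h
            · rintro ⟨rfl, rfl⟩
              have := h6.2.2 cr (by omega)
              simp only [List.mem_cons, Prod.mk.injEq] at this
              rcases this with h | h
              · omega
              · exact hc h
    | slideR =>
      cases hB2 with
      | same h5 =>
        cases hB with
        | same h4 => exact ⟨_, _, .slideR, .A (by omega)⟩
        | row h5 h6 => exact absurd ⟨rfl, rfl⟩ hne
        | col h5 h6 h7 => exact absurd ⟨rfl, rfl⟩ hne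
      | row h5 h6 =>  exact absurd (hev1 cs (by omega) hcv) hc
      | col h5 h6 h7 => exact absurd (hev1 cs (by omega) hcv) hc
    | slideD =>
      cases hB2 with
      | same h5 =>
        cases hB with
        | same h4 => exact ⟨_, _, .slideD, .A (by omega)⟩
        | row h5 h6 => exact absurd ⟨rfl, rfl⟩ hne
        | col h5 h6 h7 => exact absurd ⟨rfl, rfl⟩ hne
      | row h5 h6 =>  exact absurd (hev2 cr (by omega)) hc
      | col h5 h6 h7 => exact absurd (hev2 cr (by omega)) hc
  | E hle =>
    cases hJ with
    | same h1 h2 h3 =>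
      cases hB with
      | row h4 h5 => exact absurd ⟨rfl, rfl⟩ h1
      | col h4 h5 h6 => exact absurd ⟨rfl, rfl⟩ h1
      | same h4 =>
        cases hB2 with
        | same h5 =>
          refine ⟨_, _, .same h5 ?_ ?_, .E hle⟩
          · rintro ⟨rfl, rfl⟩
            have := hfv1 (cs + 1) (by omega) hdv
            exact hd ((hm _).2 (Or.inr this))
          · rintro ⟨rfl, rfl⟩
            have := hfv2 dr (by omega)
            exact hd ((hm _).2 (Or.inr this))
        | col h5 h6 h7 =>
          have := hcv h5
          rcases h6 with h6 | h6
          · simp at h6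
          · omega
        | row h5 h6 =>
          have hlt : dr < cr := by
            rcases hle.lt_or_eq with h | rfl
            · exact h
            · exact absurd (hfv1 cs (by omega) hcv) hc
          have : cs + 1 = q2 := by
            refine RowEnd.uniq (S := (dr, cs + 1) :: gs) ⟨fun hh => ?_, ?_, ?_⟩ h6
            · have := hcv hh; omega
            · have hn : (dr + 1, cs + 1) ∉ gs := fun hh => hd (hgs.up _ _ hh)
              exact ncons _ _ _ _ _ hn (by omega)
            · intro s' hs' hv
              exact List.mem_cons_of_mem _ (hgs.mem (r := cr) (s := cs) ((hm _).2 (Or.inl rfl)) (by omega) (by omega) hv)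
          subst this
          exact ⟨_, _, .slideD, .E (by omega)⟩
    | slideR =>
      have hdg : dr = cr := by
        rcases hle.lt_or_eq with h | h
        · exact absurd (hgv2 dr h) hd
        · exact h
      subst hdg
      cases hB with
      | same h => exact absurd ⟨rfl, rfl⟩ h
      | row h4 h5 =>
        cases hB2 with
        | same h => exact absurd ⟨rfl, rfl⟩ h
        | col h6 h7 h8 =>
          have := hcv h6
          rcases h7 with h7 | h7
          · simp at h7
          · omega
        | row h6 h7 =>
          have k1 := rowBump_corner hfs he heL h4 h5
          have : q = q2 := by
            refine RowEnd.uniq (S := (dr, cs + 1) :: gs) ⟨h5.1, ?_, ?_⟩ h7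
            · exact nsub2 _ _ _ _ h5.2.1 (by omega)
            · intro s' hs' hv
              exact sub2 _ _ (h5.2.2 s' hs' hv)
          subst this
          exact ⟨_, _, .same (by omega) (by omega) (by omega), .A (by omega)⟩
      | col h4 h5 h6 =>
        have hdiag : dr = cs := by simpa using h5
        subst hdiag
        cases hB2 with
        | same h => exact absurd ⟨rfl, rfl⟩ h
        | col h7 h8 h9 =>
          rcases h8 with h7 | h7
          · simp at h7
          · omega
        | row h7 h8 =>
          have e1 : dr = p := by
            refine ColEnd.uniq (S := (dr, dr) :: fs) ⟨hdv, ?_, ?_⟩ h6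
            · simp only [hm', not_or] at hd
              exact ncons _ _ _ _ _ hd.2 (by omega)
            · intro r' hr'
              have := hdv2 r' hr'
              simp only [hm] at this
              simpa using this
          have e2 : dr + 1 = q2 := by
            refine RowEnd.uniq (S := (dr, dr + 1) :: gs) ⟨fun _ => le_rfl, ?_, ?_⟩ h8
            · have hn : (dr + 1, dr + 1) ∉ gs := fun hh => hd (hgs.up _ _ hh)
              exact ncons _ _ _ _ _ hn (by omega)
            · intro s' hs' hv
              have := hv h4
              omega
          subst e1 e2
          exact ⟨_, _, .slideD, .F h4 (Or.inl rfl) (Or.inr rfl) le_rfl⟩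
    | slideD =>
      cases hB2 with
      | same h5 =>
        cases hB with
        | same h => exact absurd ⟨rfl, rfl⟩ h
        | col h6 h7 h8 =>
          have := hgv h6
          have : cr = cs := by simpa using h7
          omega
        | row h6 h7 =>
          have : cs = q := by
            refine RowEnd.uniq (S := (cr, cs) :: fs) ⟨hgv, ?_, ?_⟩ h7
            · simp only [hm', not_or] at hg
              exact ncons _ _ _ _ _ hg.2 (by omega)
            · intro s' hs' hv
              have := hgv1 s' hs' hv
              simp only [hm] at this
              simpa using this
          subst this
          exact ⟨_, _, .same (by omega) (by omega) (by omega), .E (by omega)⟩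
  | F hsh h2 h3 hle =>
    cases hJ with
    | same j1 j2 j3 =>
      cases hB with
      | row h4 h5 => exact absurd ⟨rfl, rfl⟩ j1
      | col h4 h5 h6 => exact absurd ⟨rfl, rfl⟩ j1
      | same h4 =>
        cases hB2 with
        | same h5 =>
          refine ⟨_, _, .same h5 ?_ ?_, .F hsh h2 h3 hle⟩
          · rintro ⟨rfl, rfl⟩
            have := hfv1 ds (by omega) hdv
            exact hd ((hm _).2 (Or.inr this))
          · rintro ⟨rfl, rfl⟩
            have := hfv2 (cr + 1) (by omega)
            exact hd ((hm _).2 (Or.inr this))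
        | row h5 h6 => exact absurd ⟨hsh, by simpa using h3⟩ h5
        | col h5 h6 h7 =>
          have hlt : ds < cs := by
            rcases hle.lt_or_eq with h | rfl
            · exact h
            · exact absurd (hfv2 cr (by omega)) hc
          have : cr + 1 = p2 := by
            refine ColEnd.uniq (S := (cr + 1, ds) :: gs) ⟨fun hh => ?_, ?_, ?_⟩ h7
            · have := hdv hh; omega
            · have hn : (cr + 1, ds + 1) ∉ gs := fun hh => hd (hgs.left _ _ hh hdv)
              exact ncons _ _ _ _ _ hn (by omega)
            · intro r' hr'
              refine List.mem_cons_of_mem _ (hgs.mem (r := cr) (s := cs) ((hm _).2 (Or.inl rfl)) (by omega) (by omega) ?_)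
              intro hh; have := hdv hh; omega
          subst this
          exact ⟨_, _, .slideR, .F hsh h2 (Or.inl rfl) (by omega)⟩
    | slideD =>
      have hdg : ds = cs := by
        rcases hle.lt_or_eq with h | h
        · exact absurd (hgv1 ds h hdv) hd
        · exact h
      subst hdg
      cases hB with
      | same h => exact absurd ⟨rfl, rfl⟩ h
      | row h4 h5 => exact absurd ⟨hsh, by simpa using h2⟩ h4
      | col h4 h5 h6 =>
        cases hB2 with
        | same h => exact absurd ⟨rfl, rfl⟩ h
        | row h7 h8 => exact absurd ⟨hsh, by simpa using h3⟩ h7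
        | col h7 h8 h9 =>
          have k1 := colBump_corner hfs he heL h6
          have : p = p2 := by
            refine ColEnd.uniq (S := (cr + 1, ds) :: gs) ⟨h6.1, ?_, ?_⟩ h9
            · exact nsub2 _ _ _ _ h6.2.1 (by omega)
            · intro s' hs'
              exact sub2 _ _ (h6.2.2 s' hs')
          subst this
          exact ⟨_, _, .same (by omega) (by omega) (by omega), .A (by omega)⟩
    | slideR =>
      cases hB2 with
      | same h5 =>
        cases hB with
        | same h => exact absurd ⟨rfl, rfl⟩ h
        | row h6 h7 => exact absurd ⟨hsh, by simpa using h2⟩ h6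
        | col h6 h7 h8 =>
          have : cr = p := by
            refine ColEnd.uniq (S := (cr, cs) :: fs) ⟨hgv, ?_, ?_⟩ h8
            · simp only [hm', not_or] at hg
              exact ncons _ _ _ _ _ hg.2 (by omega)
            · intro s' hs'
              have := hgv2 s' hs'
              simp only [hm] at this
              simpa using this
          subst this
          exact ⟨_, _, .same (by omega) (by omega) (by omega), .F hsh (Or.inl rfl) h3 (by omega)⟩

end RT

namespace RT

theorem Bump.inv {sh k F G r s t} (h : Bump sh (k + 1) F G r s t) :
    ∃ a b fs p q gs r0 s0 t0, F = (a, b) :: fs ∧ G = (p, q) :: gs ∧ Bump sh k fs gs r0 s0 t0 ∧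
      BStep sh fs a b r0 s0 t0 p q r s t := by
  cases h with
  | @same _ fs gs _ _ _ f h1 h2 =>
    exact ⟨f.1, f.2, fs, f.1, f.2, gs, _, _, _, rfl, rfl, h1,
      .same (fun hh => h2 (Prod.ext hh.1 hh.2))⟩
  | row h1 h2 h3 => exact ⟨_, _, _, _, _, _, _, _, _, rfl, rfl, h1, .row h2 h3⟩
  | col h1 h2 h3 h4 => exact ⟨_, _, _, _, _, _, _, _, _, rfl, rfl, h1, .col h2 h3 h4⟩

theorem Jdt.inv {a b p q fs gs r s} (h : Jdt ((a, b) :: fs) ((p, q) :: gs) r s) :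
    ∃ r0 s0, Jdt fs gs r0 s0 ∧ JStep r0 s0 a b p q r s := by
  cases h with
  | same h1 h2 h3 h4 =>
    simp only [ne_eq, Prod.mk.injEq] at h2 h3 h4
    exact ⟨_, _, h1, .same h2 h3 h4⟩
  | slideR h1 => exact ⟨_, _, h1, .slideR⟩
  | slideD h1 => exact ⟨_, _, h1, .slideD⟩

theorem Jdt.cons {a b p q fs gs r s r0 s0} (h : Jdt fs gs r0 s0) (hj : JStep r0 s0 a b p q r s) :
    Jdt ((a, b) :: fs) ((p, q) :: gs) r s := by
  cases hj with
  | same h2 h3 h4 =>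
    exact .same h (by simpa using h2) (by simpa using h3) (by simpa using h4)
  | slideR => exact .slideR h
  | slideD => exact .slideD h

theorem main_J {sh : Bool} (k : ℕ) : ∀ {fs fs' gs gs' er es t dr ds u cr cs},
    Bump sh k fs fs' er es t → Good sh fs → Bump sh k gs gs' dr ds u → Good sh gs →
    Jdt fs gs cr cs → ∃ Cr Cs, Jdt fs' gs' Cr Cs ∧ St sh cr cs er es t dr ds u Cr Cs := by
  induction k with
  | zero =>
    intro fs fs' gs gs' er es t dr ds u cr cs hB hG hB2 hG2 hJ
    obtain ⟨hc, hm⟩ := hJ.facts hG2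
    have hcv : V sh cr cs := hG2.low.valid _ _ ((hm _).2 (Or.inl rfl))
    cases hB with
    | start h1 =>
    cases hB2 with
    | start h2 =>
    by_cases hx : 0 = cr ∧ es = cs
    · obtain ⟨rfl, rfl⟩ := hx
      have : es + 1 = ds := by
        refine RowEnd.uniq (S := gs) ⟨fun _ => Nat.zero_le _, ?_, ?_⟩ h2
        · rw [hm]
          rintro (hh | hh)
          · simp at hh
          · exact hc (hG.low.left _ _ hh hcv)
        · intro s' hs' hv
          rcases Nat.lt_succ_iff_lt_or_eq.1 hs' with hl | rfl
          · exact (hm _).2 (Or.inr (h1.2.2 _ hl hv))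
          · simp [hm]
      subst this
      exact ⟨_, _, .slideR hJ, .E le_rfl⟩
    · have : es = ds := by
        refine RowEnd.uniq (S := gs) ⟨fun _ => Nat.zero_le _, ?_, ?_⟩ h2
        · rw [hm]
          rintro (hh | hh)
          · simp at hh; omega
          · exact h1.2.1 hh
        · intro s' hs' hv
          exact (hm _).2 (Or.inr (h1.2.2 _ hs' hv))
      subst this
      refine ⟨_, _, .same hJ (by simpa using hx) ?_ (by simp), .A hx⟩
      rintro hh
      simp only [Prod.mk.injEq] at hh
      obtain ⟨rfl, rfl⟩ := hh
      exact hc (h1.2.2 _ (by omega) hcv)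
  | succ k ih =>
    intro fs fs' gs gs' er es t dr ds u cr cs hB hG hB2 hG2 hJ
    obtain ⟨a, b, fs, p, q, fs', er0, es0, t0, rfl, rfl, hB, hS⟩ := hB.inv
    obtain ⟨a2, b2, gs, p2, q2, gs', dr0, ds0, u0, rfl, rfl, hB2, hS2⟩ := hB2.inv
    obtain ⟨cr0, cs0, hJ, hJS⟩ := hJ.inv
    obtain ⟨Cr, Cs, hJ', hSt⟩ := ih hB hG.1 hB2 hG2.1 hJ
    obtain ⟨hc, hm⟩ := hJ.facts hG2.1
    obtain ⟨-, e1, e2, -, -⟩ := hB.facts hG.1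
    obtain ⟨-, d1, d2, -, -⟩ := hB2.facts hG2.1
    obtain ⟨Cr', Cs', j, st⟩ := hSt.step hG.1.low hG2.1.low hc hm e1 e2 d1 d2 hG.2.1 hG.2.2
      hG2.2.1 hG2.2.2 hJS hS hS2
    exact ⟨Cr', Cs', hJ'.cons j, st⟩

theorem main_J0 {sh k fs gs r s t} (h : Bump sh k fs gs r s t) (hG : Good sh fs)
    (hk : k = fs.length) :
    Jdt fs gs r s ∧ (sh = true → r = 0 ∧ (t = true ∨ s = 0)) ∧ (sh = false → s = 0) := by
  induction h with
  | @start fs s h =>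
    obtain rfl : fs = [] := List.length_eq_zero_iff.1 hk.symm
    have : s = 0 := by
      by_contra hs
      have := h.2.2 0 (by omega) (fun _ => le_rfl)
      simp at this
    subst this
    exact ⟨.nil, by simp, by simp⟩
  | @same k fs gs r s t f hb hne ih =>
    obtain ⟨i1, i2, i3⟩ := ih hG.1 (by simpa using hk)
    obtain ⟨-, e1, e2, -, -⟩ := hb.facts hG.1
    obtain ⟨a, b⟩ := f
    have f1 := hG.2.2.rowEnd hG.2.1
    have f2 := hG.2.2.colEnd hG.2.1
    refine ⟨.same i1 hne ?_ ?_, i2, i3⟩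
    · intro hh
      simp only [Prod.mk.injEq] at hh
      obtain ⟨rfl, rfl⟩ := hh
      exact e1 (f1.2.2 _ (by omega) (e2.valid _ _ (by simp)))
    · intro hh
      simp only [Prod.mk.injEq] at hh
      obtain ⟨rfl, rfl⟩ := hh
      exact e1 (f2.2.2 _ (by omega))
  | @row k fs gs r s s' hb hd he ih =>
    obtain ⟨i1, i2, i3⟩ := ih hG.1 (by simpa using hk)
    obtain ⟨-, e1, e2, -, -⟩ := hb.facts hG.1
    have := (rowBump_corner hG.1.low e1 e2 hd he).1
    cases sh with
    | true =>
      have := i2 rfl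
      simp at this
      simp at hd
      omega
    | false =>
      have := i3 rfl
      subst this
      obtain rfl : s' = 0 := by omega
      exact ⟨.slideD i1, by simp, by simp⟩
  | @col k fs gs r s t r' hb hsh ht he ih =>
    obtain ⟨i1, i2, i3⟩ := ih hG.1 (by simpa using hk)
    obtain ⟨-, e1, e2, -, -⟩ := hb.facts hG.1
    have := (colBump_corner hG.1.low e1 e2 he).1
    subst hsh
    obtain ⟨rfl, -⟩ := i2 rfl
    obtain rfl : r' = 0 := by omega
    exact ⟨.slideR i1, by simp, by simp⟩

theorem max_split (l : List ℕ) (hl : l ≠ []) :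
    ∃ a n b, l = a ++ n :: b ∧ (∀ x ∈ a, x < n) ∧ (∀ x ∈ b, x ≤ n) := by
  induction l with
  | nil => exact absurd rfl hl
  | cons y l ih =>
    by_cases h : l = []
    · subst h; exact ⟨[], y, [], by simp⟩
    · obtain ⟨a, n, b, rfl, h1, h2⟩ := ih h
      by_cases hy : n ≤ y
      · refine ⟨[], y, a ++ n :: b, rfl, by simp, ?_⟩
        intro x hx
        simp only [List.mem_append, List.mem_cons] at hx
        rcases hx with hx | rfl | hx
        · have := h1 x hx; omega
        · exact hy
        · have := h2 x hx; omega
      · refine ⟨y :: a, n, b, rfl, ?_, h2⟩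
        intro x hx
        simp only [List.mem_cons] at hx
        rcases hx with rfl | hx
        · omega
        · exact h1 x hx

theorem jdt_cells {sh : Bool} (cells : List ℕ → List (ℕ × ℕ)) 
    (hlen : ∀ w, (cells w).length = w.length)
    (hG : ∀ w, (∀ x ∈ w, 1 ≤ x) → Good sh (cells w))
    (hD : ∀ a n b, (∀ x ∈ a ++ n :: b, 1 ≤ x) → (∀ x ∈ a, x < n) → (∀ x ∈ b, x ≤ n) →
      ∃ r s t, Bump sh a.length (cells (a ++ b)) (cells (a ++ n :: b)) r s t) :
    ∀ (m : ℕ) (u : List ℕ) (x : ℕ), u.length = m → (∀ y ∈ u ++ [x], 1 ≤ y) →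
      ∃ r s, Jdt (cells u) (cells (u ++ [x])) r s := by
  intro m
  induction m with
  | zero =>
    intro u x hu hpos
    obtain rfl : u = [] := List.length_eq_zero_iff.1 hu
    obtain ⟨r, s, t, h⟩ := hD [] x [] (by simpa using hpos) (by simp) (by simp)
    exact ⟨r, s, (main_J0 h (hG _ (by simp)) (by simp [hlen])).1⟩
  | succ m ih =>
    intro u x hu hpos
    obtain ⟨a, n, b, rfl, h1, h2⟩ := max_split u (by rintro rfl; simp at hu)
    by_cases hx : n < x
    · obtain ⟨r, s, t, h⟩ := hD (a ++ n :: b) x [] hpos (by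
        intro y hy
        simp only [List.mem_append, List.mem_cons] at hy
        rcases hy with hy | rfl | hy
        · have := h1 y hy; omega
        · exact hx
        · have := h2 y hy; omega) (by simp)
      rw [List.append_nil] at h
      refine ⟨r, s, (main_J0 h (hG _ ?_) (by simp [hlen])).1⟩
      intro y hy; exact hpos y (by simp only [List.mem_append] at hy ⊢; tauto)
    · obtain ⟨r, s, t, h⟩ := hD a n b (fun y hy => hpos y (List.mem_append_left _ hy)) h1 h2
      obtain ⟨r', s', t', h'⟩ := hD a n (b ++ [x]) (fun y hy => hpos y (by simpa using hy)) h1 (by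
        intro y hy
        simp only [List.mem_append, List.mem_singleton] at hy
        rcases hy with hy | rfl
        · exact h2 y hy
        · omega)
      have hp1 : ∀ y ∈ (a ++ b) ++ [x], 1 ≤ y := by
        intro y hy
        apply hpos
        simp only [List.mem_append, List.mem_cons] at hy ⊢; tauto
      obtain ⟨cr, cs, hJ⟩ := ih (a ++ b) x (by simp at hu ⊢; omega) hp1
      rw [List.append_assoc] at hJ hp1
      obtain ⟨Cr, Cs, hJ', -⟩ := main_J _ h (hG _ (fun y hy => hp1 y (by
        simp only [List.mem_append] at hy ⊢; tauto))) h' (hG _ hp1) hJ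
      exact ⟨Cr, Cs, by simpa using hJ'⟩

def fill : List (ℕ × ℕ) → (ℕ × ℕ) → ℕ
  | [] => fun _ => 0
  | f :: fs => Function.update (fill fs) f (fs.length + 1)

theorem fill_le (l : List (ℕ × ℕ)) (x) : fill l x ≤ l.length := by
  induction l with
  | nil => simp [fill]
  | cons f fs ih =>
    simp only [fill, Function.update_apply, List.length_cons]
    split_ifs <;> omega

theorem fill_eq_zero {l : List (ℕ × ℕ)} {x} (h : x ∉ l) : fill l x = 0 := by
  induction l with
  | nil => simp [fill]
  | cons f fs ih =>
    simp only [List.mem_cons, not_or] at h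
    simp [fill, h.1, ih h.2]

theorem jdtSlide_done (N : ℕ) (f : ℕ × ℕ → ℕ) (a b : ℕ) (h1 : f (a, b + 1) = 0)
    (h2 : f (a + 1, b) = 0) : jdtSlide N f (a, b) = (f, (a, b)) := by
  cases N <;> simp [jdtSlide, h1, h2]

theorem slide_term (N : ℕ) (f : ℕ × ℕ → ℕ) (a b p q M : ℕ) (h0 : f (p, q) = 0)
    (h1 : f (a, b + 1) = 0) (h2 : f (a + 1, b) = 0) (h3 : f (p, q + 1) = 0)
    (h4 : f (p + 1, q) = 0) (hM : 0 < M) :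
    jdtSlide (N + 1) (Function.update f (p, q) M) (a, b) =
      if (p, q) = (a, b + 1) ∨ (p, q) = (a + 1, b) then (Function.update f (a, b) M, (p, q))
      else (Function.update f (p, q) M, (a, b)) := by
  by_cases hA : (p, q) = (a, b + 1)
  · simp only [Prod.mk.injEq] at hA
    obtain ⟨rfl, rfl⟩ := hA
    have e : Function.update f (p, b + 1) 0 = f := Function.update_eq_self_iff.2 h0.symm
    have hs := jdtSlide_done N (Function.update f (p, b) M) p (b + 1) 
        (by rw [Function.update_of_ne (by simp <;> omega)]; exact h3)
        (by rw [Function.update_of_ne (by simp <;> omega)]; exact h4)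
    simp [jdtSlide, h2, hM.ne', e, hs]
  · by_cases hB : (p, q) = (a + 1, b)
    · simp only [Prod.mk.injEq] at hB
      obtain ⟨rfl, rfl⟩ := hB
      have e : Function.update f (a + 1, q) 0 = f := Function.update_eq_self_iff.2 h0.symm
      have hs := jdtSlide_done N (Function.update f (a, q) M) (a + 1) q 
        (by rw [Function.update_of_ne (by simp <;> omega)]; exact h3)
        (by rw [Function.update_of_ne (by simp <;> omega)]; exact h4)
      simp [jdtSlide, h1, hM.ne', e, hs]
    · rw [if_neg (by tauto)]
      apply jdtSlide_done
      · rw [Function.update_of_ne (fun h => hA h.symm), h1]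
      · rw [Function.update_of_ne (fun h => hB h.symm), h2]

theorem slide_step (N : ℕ) : ∀ (f f' : ℕ × ℕ → ℕ) (a b : ℕ) (c : ℕ × ℕ) (p q : ℕ) (M : ℕ),
    jdtSlide N f (a, b) = (f', c) → f (p, q) = 0 → (p, q) ≠ (a, b) →
    f' (c.1, c.2 + 1) = 0 → f' (c.1 + 1, c.2) = 0 →
    f' (p, q + 1) = 0 → f' (p + 1, q) = 0 → (∀ x, f x < M) →
    jdtSlide (N + 1) (Function.update f (p, q) M) (a, b) =
      if (p, q) = (c.1, c.2 + 1) ∨ (p, q) = (c.1 + 1, c.2) then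
        (Function.update f' c M, (p, q))
      else (Function.update f' (p, q) M, c) := by
  induction N with
  | zero =>
    intro f f' a b c p q M h h0 hne h1 h2 h3 h4 hM
    simp only [jdtSlide, Prod.mk.injEq] at h
    obtain ⟨rfl, rfl⟩ := h
    exact slide_term 0 f a b p q M h0 h1 h2 h3 h4 (by have := hM (0, 0); omega)
  | succ N ih =>
    intro f f' a b c p q M h h0 hne h1 h2 h3 h4 hM
    have hM0 : 0 < M := by have := hM (0, 0); omega
    by_cases hz : f (a, b + 1) = 0 ∧ f (a + 1, b) = 0
    · rw [jdtSlide_done _ _ _ _ hz.1 hz.2] at h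
      simp only [Prod.mk.injEq] at h
      obtain ⟨rfl, rfl⟩ := h
      exact slide_term _ f a b p q M h0 h1 h2 h3 h4 hM0
    · have hMr := hM (a, b + 1)
      have hMd := hM (a + 1, b)
      rw [jdtSlide] at h
      simp only [hz, if_false] at h
      by_cases hc : f (a + 1, b) = 0 ∨ (f (a, b + 1) ≠ 0 ∧ f (a, b + 1) < f (a + 1, b))
      · rw [if_pos hc] at h
        have hr : f (a, b + 1) ≠ 0 := by omega
        have hpr : (p, q) ≠ (a, b + 1) := by intro hh; rw [hh] at h0; exact hr h0
        have := ih _ _ _ _ _ p q M h (by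
          rw [Function.update_of_ne hne, Function.update_of_ne hpr, h0]) hpr h1 h2 h3 h4 (by
          intro x
          simp only [Function.update_apply]
          split_ifs
          · exact hMr
          · exact hM0
          · exact hM x)
        rw [← this, jdtSlide]
        have e1 : Function.update f (p, q) M (a, b + 1) = f (a, b + 1) :=
          Function.update_of_ne hpr.symm _ _
        simp only [e1, hr, false_and, if_false, ne_eq, not_false_eq_true, true_and]
        rw [if_pos]
        · rw [Function.update_comm hpr, Function.update_comm hne]
        · rw [Function.update_apply]
          split_ifs
          · right; exact hMr
          · omega
      · rw [if_neg hc] at h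
        have hr : f (a + 1, b) ≠ 0 := by omega
        have hpr : (p, q) ≠ (a + 1, b) := by intro hh; rw [hh] at h0; exact hr h0
        have := ih _ _ _ _ _ p q M h (by
          rw [Function.update_of_ne hne, Function.update_of_ne hpr, h0]) hpr h1 h2 h3 h4 (by
          intro x
          simp only [Function.update_apply]
          split_ifs
          · exact hMd
          · exact hM0
          · exact hM x)
        rw [← this, jdtSlide]
        have e1 : Function.update f (p, q) M (a + 1, b) = f (a + 1, b) :=
          Function.update_of_ne hpr.symm _ _
        simp only [e1, hr, and_false, if_false, ne_eq, false_or]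
        rw [if_neg]
        · rw [Function.update_comm hpr, Function.update_comm hne]
        · rw [Function.update_apply]
          split_ifs
          · omega
          · omega

theorem Jdt.zero_mem {fs gs r s} (h : Jdt fs gs r s) : (0, 0) ∈ gs := by
  induction h <;> simp [*]

theorem Jdt.len {fs gs r s} (h : Jdt fs gs r s) : gs.length = fs.length + 1 := by
  induction h <;> simp [*]

theorem fill_sub_cons (g : ℕ × ℕ) (gs : List (ℕ × ℕ)) :
    (fun c => fill (g :: gs) c - 1) = Function.update (fun c => fill gs c - 1) g gs.length := by
  funext c
  simp only [fill, Function.update_apply]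
  split_ifs <;> simp

theorem delta_aux {sh fs gs r s} (h : Jdt fs gs r s) (hG : Good sh fs) (hG2 : Good sh gs) :
    jdtSlide gs.length (fun c => fill gs c - 1) (0, 0) = (fill fs, (r, s)) := by
  have key : ∀ fs gs r s, Jdt fs gs r s → Good sh fs → Good sh gs → ∀ p q, (p, q) ∉ fs →
      V sh p q → fill fs (p, q + 1) = 0 ∧ fill fs (p + 1, q) = 0 := by
    intro fs gs r s h hG hG2 p q hp hv
    exact ⟨fill_eq_zero (fun hh => hp (hG.low.left _ _ hh hv)),
      fill_eq_zero (fun hh => hp (hG.low.up _ _ hh))⟩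
  have main : ∀ fs gs r s, Jdt fs gs r s → Good sh fs → Good sh gs →
      jdtSlide gs.length (fun c => fill gs c - 1) (0, 0) = (fill fs, (r, s)) →
      ∀ p q, (p, q) ∉ gs → V sh p q → 
      jdtSlide (gs.length + 1) (fun c => fill ((p, q) :: gs) c - 1) (0, 0) = 
      if (p, q) = (r, s + 1) ∨ (p, q) = (r + 1, s) then
        (Function.update (fill fs) (r, s) gs.length, (p, q))
      else (Function.update (fill fs) (p, q) gs.length, (r, s)) := by
    intro fs gs r s h hG hG2 hj p q hp hv
    obtain ⟨hc, hm⟩ := h.facts hG2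
    have h1 := key _ _ _ _ h hG hG2 r s hc (hG2.low.valid _ _ ((hm _).2 (Or.inl rfl)))
    have h2 := key _ _ _ _ h hG hG2 p q (fun hh => hp ((hm _).2 (Or.inr hh))) hv
    rw [fill_sub_cons]
    refine slide_step _ _ _ _ _ _ _ _ _ hj ?_ ?_ h1.1 h1.2 h2.1 h2.2 ?_
    · simp [fill_eq_zero hp]
    · rintro hh; rw [hh] at hp; exact hp h.zero_mem
    · intro x
      have := fill_le gs x
      have := h.len
      omega
  induction h with
  | nil =>
    have : (fun c => fill [(0, 0)] c - 1) = fill [] := by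
      funext c
      simp only [fill, Function.update_apply]
      split_ifs <;> simp
    rw [this]
    apply jdtSlide_done <;> simp [fill]
  | @same fs gs r s f h h1 h2 h3 ih =>
    obtain ⟨p, q⟩ := f
    have := main _ _ _ _ h hG.1 hG2.1 (ih hG.1 hG2.1) p q hG2.2.1 (hG2.2.2.valid _ _ (by simp))
    rw [if_neg (by tauto), h.len] at this
    rw [List.length_cons, h.len, this]
    rfl
  | @slideR fs gs r s h ih =>
    have := main _ _ _ _ h hG.1 hG2.1 (ih hG.1 hG2.1) _ _ hG2.2.1 (hG2.2.2.valid _ _ (by simp))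
    rw [if_pos (by tauto), h.len] at this
    rw [List.length_cons, h.len, this]
    rfl
  | @slideD fs gs r s h ih =>
    have := main _ _ _ _ h hG.1 hG2.1 (ih hG.1 hG2.1) _ _ hG2.2.1 (hG2.2.2.valid _ _ (by simp))
    rw [if_pos (by tauto), h.len] at this
    rw [List.length_cons, h.len, this]
    rfl

theorem delta_fill {sh fs gs r s} (h : Jdt fs gs r s) (hG : Good sh fs) (hG2 : Good sh gs) :
    deltaOp gs.length (fill gs) = fill fs := by
  rw [deltaOp, delta_aux h hG hG2]

end RT

namespace RT

def rows (T : List (List ℕ)) (r : ℕ) : List ℕ := T.getD r []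

theorem tsize_eq (T : List (List ℕ)) : ∀ N, T.length ≤ N →
    tsize T = ∑ r ∈ Finset.range N, (rows T r).length := by
  induction T with
  | nil => intro N _; simp [tsize, rows]
  | cons row T ih =>
    intro N hN
    obtain ⟨N, rfl⟩ : ∃ k, N = k + 1 := ⟨N - 1, by simp at hN; omega⟩
    rw [Finset.sum_range_succ']
    have := ih N (by simpa using hN)
    simp only [tsize, List.map_cons, List.sum_cons] at this ⊢
    rw [this]
    simp [rows, add_comm]

theorem tsize_succ {T T' : List (List ℕ)} (k : ℕ)
    (h1 : ∀ r, r ≠ k → (rows T' r).length = (rows T r).length)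
    (h2 : (rows T' k).length = (rows T k).length + 1) : tsize T' = tsize T + 1 := by
  rw [tsize_eq T (T.length + T'.length + k + 1) (by omega),
    tsize_eq T' (T.length + T'.length + k + 1) (by omega)]
  have hk : k ∈ Finset.range (T.length + T'.length + k + 1) := Finset.mem_range.2 (by omega)
  rw [← Finset.add_sum_erase _ _ hk, ← Finset.add_sum_erase (Finset.range _) _ hk, h2]
  rw [Finset.sum_congr rfl (fun r hr => h1 r (Finset.ne_of_mem_erase hr))]
  omega

theorem rows_setBox (T : List (List ℕ)) (r j v r' : ℕ) :
    rows (setBox T r j v) r' = if r' = r then padSet (rows T r) j v else rows T r' := by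
  have aux : ∀ k, (T ++ List.replicate k ([] : List ℕ)).getD r' [] = T.getD r' [] := by
    intro k
    simp only [List.getD_eq_getElem?_getD, List.getElem?_append, List.getElem?_replicate]
    split_ifs with h1 h2 <;> simp_all
  have aux2 : ∀ k, (T ++ List.replicate k ([] : List ℕ)).getD r [] = T.getD r [] := by
    intro k
    simp only [List.getD_eq_getElem?_getD, List.getElem?_append, List.getElem?_replicate]
    split_ifs with h1 h2 <;> simp_all
  unfold rows setBox
  by_cases hr : r < T.length
  · simp only [hr, if_true]
    simp only [List.getD_eq_getElem?_getD, List.getElem?_set]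
    by_cases h : r = r'
    · subst h; simp [hr]
    · simp [h, Ne.symm h]
  · simp only [hr, if_false]
    rw [aux2]
    by_cases h : r = r'
    · subst h
      simp only [List.getD_eq_getElem?_getD, List.getElem?_set, if_true]
      rw [if_pos (by simp; omega)]
      rfl
    · rw [if_neg (Ne.symm h), ← aux (r + 1 - T.length)]
      simp only [List.getD_eq_getElem?_getD, List.getElem?_set, h, if_false]

theorem padSet_length (l : List ℕ) (v : ℕ) : padSet l l.length v = l ++ [v] := by
  simp [padSet]

theorem padSet_getD (l : List ℕ) (j v i : ℕ) :
    (padSet l j v).getD i 0 = if i = j then v else l.getD i 0 := by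
  unfold padSet
  by_cases hj : j < l.length
  · simp only [hj, if_true, List.getD_eq_getElem?_getD, List.getElem?_set]
    by_cases h : j = i
    · subst h; simp
    · simp [h, Ne.symm h]
  · simp only [hj, if_false]
    simp only [List.getD_eq_getElem?_getD, List.getElem?_append, List.length_append,
      List.length_replicate, List.getElem?_replicate]
    by_cases h1 : i < l.length
    · rw [if_pos (by omega), if_pos h1, if_neg (by omega)]
    · have h2 : l[i]? = none := by simp; omega
      rw [h2]
      by_cases h3 : i = j
      · subst h3
        rw [if_neg (by omega)]
        simp
        have : i - (l.length + (i - l.length)) = 0 := by omega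
        simp [this]
      · rw [if_neg h3]
        by_cases h4 : i < l.length + (j - l.length)
        · rw [if_pos h4, if_neg h1, if_pos (by omega)]; rfl
        · rw [if_neg h4]
          have : i - (l.length + (j - l.length)) ≠ 0 := by omega
          obtain ⟨k, hk⟩ := Nat.exists_eq_succ_of_ne_zero this
          rw [hk]; simp

theorem toFunStraight_setBox (T : List (List ℕ)) (r j v : ℕ) :
    toFunStraight (setBox T r j v) = Function.update (toFunStraight T) (r, j) v := by
  funext ⟨a, b⟩
  have := rows_setBox T r j v a
  simp only [rows] at this
  simp only [toFunStraight, this, Function.update_apply, Prod.mk.injEq]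
  by_cases h : a = r
  · subst h; simp only [if_true, padSet_getD, true_and]
  · simp [h]

theorem toFunShifted_setBox (T : List (List ℕ)) (r s v : ℕ) (h : r ≤ s) :
    toFunShifted (setBox T r (s - r) v) = Function.update (toFunShifted T) (r, s) v := by
  funext ⟨a, b⟩
  have := rows_setBox T r (s - r) v a
  simp only [rows] at this
  simp only [toFunShifted, this, Function.update_apply, Prod.mk.injEq]
  by_cases h' : a = r
  · subst h'
    simp only [if_true, padSet_getD, true_and]
    by_cases h2 : b = s
    · subst h2; simp [h]
    · by_cases h3 : a ≤ b
      · have : b - a ≠ s - a := by omega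
        simp [h2, h3, this]
      · simp [h2, h3]
  · simp [h']

def off (sh : Bool) (r : ℕ) : ℕ := if sh = true then r else 0

def ShapeOf (sh : Bool) (T : List (List ℕ)) (S : List (ℕ × ℕ)) : Prop :=
  ∀ r j, j < (rows T r).length ↔ (r, j + off sh r) ∈ S

theorem ShapeOf.len {sh T S r s} (h : ShapeOf sh T S) (he : RowEnd sh S r s) :
    (rows T r).length + off sh r = s ∧ (rows T r).length = s - off sh r := by
  have hv : off sh r ≤ s := by
    unfold off; split_ifs with hh
    · exact he.1 hh
    · omega
  have h1 : ¬ (s - off sh r < (rows T r).length) := by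
    rw [h]
    rw [Nat.sub_add_cancel hv]
    exact he.2.1
  have h2 : (rows T r).length ≤ s - off sh r := by omega
  rcases h2.lt_or_eq with h3 | h3
  · exfalso
    have := he.2.2 ((rows T r).length + off sh r) (by omega) (by
      intro hh; simp [off, hh])
    rw [← h] at this
    omega
  · omega

theorem ShapeOf.rowEnd {sh T S r} (h : ShapeOf sh T S) :
    RowEnd sh S r ((rows T r).length + off sh r) := by
  refine ⟨fun hh => by simp [off, hh], ?_, ?_⟩
  · rw [← h]; omega
  · intro s' hs hv
    have hv : off sh r ≤ s' := by
      unfold off; split_ifs with hh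
      · exact hv hh
      · omega
    have := (h r (s' - off sh r)).1 (by omega)
    rwa [Nat.sub_add_cancel hv] at this

theorem ShapeOf.append {sh T T' S r s v} (h : ShapeOf sh T S) (he : RowEnd sh S r s)
    (h1 : ∀ r', rows T' r' = if r' = r then rows T r ++ [v] else rows T r') :
    ShapeOf sh T' ((r, s) :: S) := by
  intro a j
  rw [h1]
  by_cases ha : a = r
  · subst ha
    simp only [if_true, List.length_append, List.length_singleton, List.mem_cons, Prod.mk.injEq,
      true_and]
    rw [← h, ← (h.len he).1]
    omega
  · simp only [ha, if_false, List.mem_cons, Prod.mk.injEq, false_and, false_or]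
    exact h a j

theorem tsize_append {T T' : List (List ℕ)} {r v : ℕ} 
    (h1 : ∀ r', rows T' r' = if r' = r then rows T r ++ [v] else rows T r') :
    tsize T' = tsize T + 1 := by
  refine tsize_succ r ?_ ?_
  · intro r' hr; rw [h1, if_neg hr]
  · rw [h1]; simp

def Qr (sh : Bool) : List (ℕ × ℕ) → List (List ℕ)
  | [] => []
  | f :: fs => setBox (Qr sh fs) f.1 (f.2 - off sh f.1) (tsize (Qr sh fs) + 1)

theorem Qr_facts {sh : Bool} (fs : List (ℕ × ℕ)) (hG : Good sh fs) :
    ShapeOf sh (Qr sh fs) fs ∧ tsize (Qr sh fs) = fs.length := by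
  induction fs with
  | nil => simp [ShapeOf, Qr, rows, tsize]
  | cons f fs ih =>
    obtain ⟨h1, h2⟩ := ih hG.1
    obtain ⟨r, s⟩ := f
    have he := hG.2.2.rowEnd hG.2.1
    have hl := h1.len he
    have hr : ∀ r', rows (Qr sh ((r, s) :: fs)) r' = if r' = r then
        rows (Qr sh fs) r ++ [tsize (Qr sh fs) + 1] else rows (Qr sh fs) r' := by
      intro r'
      simp only [Qr]
      rw [← hl.2, rows_setBox, padSet_length]
    exact ⟨h1.append he hr, by rw [tsize_append hr, h2]; simp⟩

theorem Qr_straight (fs : List (ℕ × ℕ)) (hG : Good false fs) :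
    toFunStraight (Qr false fs) = fill fs := by
  induction fs with
  | nil => funext c; simp [toFunStraight, Qr, fill]
  | cons f fs ih =>
    rw [fill, ← ih hG.1, Qr, toFunStraight_setBox, (Qr_facts fs hG.1).2]
    simp [off]

theorem Qr_shifted (fs : List (ℕ × ℕ)) (hG : Good true fs) :
    toFunShifted (Qr true fs) = fill fs := by
  induction fs with
  | nil => funext c; simp [toFunShifted, Qr, fill]
  | cons f fs ih =>
    obtain ⟨r, s⟩ := f
    have := hG.2.2.valid r s (by simp) rfl
    rw [fill, ← ih hG.1, Qr]
    simp only [off, if_true]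
    rw [toFunShifted_setBox _ _ _ _ this, (Qr_facts fs hG.1).2]

end RT


namespace RT

open Function

def Fl (F : ℕ × ℕ → ℕ) (v : ℕ) (c : ℕ × ℕ) : Prop := 0 < F c ∧ F c ≤ v

/-- all cells before `(r, s)` in row (resp. column) `i` are filled by entries at most `v` -/
def Spot (sh : Bool) (F : ℕ × ℕ → ℕ) (m : Bool) (i v r s : ℕ) : Prop :=
  V sh r s ∧ (m = true → r = i ∧ ∀ s' < s, V sh r s' → Fl F v (r, s')) ∧
    (m = false → s = i ∧ ∀ r' < r, Fl F v (r', s))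

def prime (z : ℕ) : ℕ := if z % 2 = 0 then z - 1 else z

/-- the insertion procedure on fillings, as a relation (with number of steps) -/
inductive Ins (sh : Bool) : ℕ → (ℕ × ℕ → ℕ) → Bool → ℕ → ℕ → (ℕ × ℕ → ℕ) → ℕ × ℕ → Prop
  | ended {F m i v r s} : Spot sh F m i v r s → F (r, s) = 0 →
      (∀ s' < s, V sh r s' → 0 < F (r, s')) →
      Ins sh 1 F m i v (update F (r, s) v) (r, s)
  | toRow {k F m i v r s F' f} : Spot sh F m i v r s → v < F (r, s) →
      ¬ (sh = true ∧ r = s) → F (r, s) % 2 = 0 →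
      Ins sh k (update F (r, s) v) true (r + 1) (F (r, s)) F' f → Ins sh (k + 1) F m i v F' f
  | toCol {k F m i v r s F' f} : Spot sh F m i v r s → v < F (r, s) →
      sh = true → (r = s ∨ F (r, s) % 2 = 1) →
      Ins sh k (update F (r, s) v) false (s + 1) (prime (F (r, s))) F' f →
      Ins sh (k + 1) F m i v F' f

theorem Spot.uniq {sh F m i v r s r' s'} (h : Spot sh F m i v r s) (h' : Spot sh F m i v r' s')
    (hs : ¬ Fl F v (r, s)) (hs' : ¬ Fl F v (r', s')) : r = r' ∧ s = s' := by
  cases m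
  · obtain ⟨h1, h2⟩ := h.2.2 rfl
    obtain ⟨h3, h4⟩ := h'.2.2 rfl
    subst h1 h3
    refine ⟨?_, rfl⟩
    rcases lt_trichotomy r r' with hl | hl | hl
    · exact absurd (h4 _ hl) hs
    · exact hl
    · exact absurd (h2 _ hl) hs'
  · obtain ⟨h1, h2⟩ := h.2.1 rfl
    obtain ⟨h3, h4⟩ := h'.2.1 rfl
    subst h1 h3
    refine ⟨rfl, ?_⟩
    rcases lt_trichotomy s s' with hl | hl | hl
    · exact absurd (h4 _ hl h.1) hs
    · exact hl
    · exact absurd (h2 _ hl h'.1) hs'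

theorem not_Fl_zero {F v c} (h : F c = 0) : ¬ Fl F v c := fun k => by have := k.1; omega
theorem not_Fl_lt {F v c} (h : v < F c) : ¬ Fl F v c := fun k => by have := k.2; omega

theorem Ins.det {sh k F m i v F' f} (h : Ins sh k F m i v F' f) :
    ∀ {k2 F2 f2}, Ins sh k2 F m i v F2 f2 → F' = F2 ∧ f = f2 := by
  induction h with
  | ended h1 h2 h3 =>
    intro k2 F2 f2 h'
    cases h' with
    | ended g1 g2 g3 =>
      obtain ⟨rfl, rfl⟩ := h1.uniq g1 (not_Fl_zero h2) (not_Fl_zero g2)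
      exact ⟨rfl, rfl⟩
    | toRow g1 g2 g3 g4 g5 =>
      obtain ⟨rfl, rfl⟩ := h1.uniq g1 (not_Fl_zero h2) (not_Fl_lt g2)
      omega
    | toCol g1 g2 g3 g4 g5 =>
      obtain ⟨rfl, rfl⟩ := h1.uniq g1 (not_Fl_zero h2) (not_Fl_lt g2)
      omega
  | toRow h1 h2 h3 h4 h5 ih =>
    intro k2 F2 f2 h'
    cases h' with
    | ended g1 g2 g3 =>
      obtain ⟨rfl, rfl⟩ := h1.uniq g1 (not_Fl_lt h2) (not_Fl_zero g2)
      omega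
    | toRow g1 g2 g3 g4 g5 =>
      obtain ⟨rfl, rfl⟩ := h1.uniq g1 (not_Fl_lt h2) (not_Fl_lt g2)
      exact ih g5
    | toCol g1 g2 g3 g4 g5 =>
      obtain ⟨rfl, rfl⟩ := h1.uniq g1 (not_Fl_lt h2) (not_Fl_lt g2)
      exact (g4.elim (fun h => h3 ⟨g3, h⟩) (by omega)).elim
  | toCol h1 h2 h3 h4 h5 ih =>
    intro k2 F2 f2 h'
    cases h' with
    | ended g1 g2 g3 =>
      obtain ⟨rfl, rfl⟩ := h1.uniq g1 (not_Fl_lt h2) (not_Fl_zero g2)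
      omega
    | toRow g1 g2 g3 g4 g5 =>
      obtain ⟨rfl, rfl⟩ := h1.uniq g1 (not_Fl_lt h2) (not_Fl_lt g2)
      exact (h4.elim (fun h => g3 ⟨h3, h⟩) (by omega)).elim
    | toCol g1 g2 g3 g4 g5 =>
      obtain ⟨rfl, rfl⟩ := h1.uniq g1 (not_Fl_lt h2) (not_Fl_lt g2)
      exact ih g5

theorem prime_le (z : ℕ) : prime z ≤ z := by unfold prime; split_ifs <;> omega
theorem prime_facts {z : ℕ} (h : 0 < z) : prime z % 2 = 1 ∧ 0 < prime z ∧
    (prime z = z ∨ prime z + 1 = z) ∧ (z % 2 = 1 → prime z = z) := by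
  unfold prime; split_ifs <;> omega

theorem Ins.bound {sh k F m i v F' f} (h : Ins sh k F m i v F' f) {N : ℕ} (hF : ∀ c, F c ≤ N)
    (hv : v ≤ N) : ∀ c, F' c ≤ N := by
  have upd : ∀ (F : ℕ × ℕ → ℕ) (c : ℕ × ℕ) (v : ℕ), (∀ c, F c ≤ N) → v ≤ N →
      ∀ c', update F c v c' ≤ N := by
    intro F c v h1 h2 c'
    rw [update_apply]; split_ifs
    · exact h2
    · exact h1 _
  induction h with
  | ended h1 h2 h3 => exact upd _ _ _ hF hv
  | toRow h1 h2 h3 h4 h5 ih => exact ih (upd _ _ _ hF hv) (hF _)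
  | toCol h1 h2 h3 h4 h5 ih => exact ih (upd _ _ _ hF hv) ((prime_le _).trans (hF _))

def Cond (n : ℕ) (F : ℕ × ℕ → ℕ) (r s E : ℕ) : Prop :=
  (E = 2 * n ∧ ∀ r' < r, ∀ s', F (r', s') ≠ 2 * n) ∨
  (E + 1 = 2 * n ∧ (∀ c, F c ≠ 2 * n) ∧ ∀ s' < s, ∀ r', F (r', s') + 1 ≠ 2 * n)

structure VC (n : ℕ) (m : Bool) (i v r s E : ℕ) : Prop where
  e : m = true → v % 2 = 0
  o : m = false → v % 2 = 1
  le : v ≤ 2 * n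
  pos : 0 < v
  c1 : E = 2 * n → m = true → v = 2 * n → r < i
  c2 : E + 1 = 2 * n → v < 2 * n ∧ (m = false → v + 1 = 2 * n → s < i)

theorem VC.lt {n m i v r s E} (h : VC n m i v r s E) (hE : E = 2 * n ∨ E + 1 = 2 * n)
    (hm : m = true → r = i) (hm' : m = false → s = i) : v < E := by
  have := h.e; have := h.o; have := h.le; have := h.c1; have := h.c2
  cases m <;> simp at * <;> omega

theorem Cond.hE {n F r s E} (h : Cond n F r s E) : E = 2 * n ∨ E + 1 = 2 * n :=
  h.imp (·.1) (·.1)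

theorem Spot.plus {sh F m i v r s e E} (h : Spot sh F m i v r s) (he : F e = 0) :
    Spot sh (update F e E) m i v r s := by
  have aux : ∀ c, Fl F v c → Fl (update F e E) v c := by
    intro c hc
    have : c ≠ e := by rintro rfl; have := hc.1; omega
    unfold Fl; rw [update_of_ne this]; exact hc
  exact ⟨h.1, fun hm => ⟨(h.2.1 hm).1, fun s' hs hv => aux _ ((h.2.1 hm).2 s' hs hv)⟩,
    fun hm => ⟨(h.2.2 hm).1, fun s' hs => aux _ ((h.2.2 hm).2 s' hs)⟩⟩

theorem Cond.upd {n F r s E r0 s0 v} (h : Cond n F r s E)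
    (h1 : E = 2 * n → r0 < r → v ≠ 2 * n) (h2 : E + 1 = 2 * n → v ≠ 2 * n)
    (h3 : E + 1 = 2 * n → s0 < s → v + 1 ≠ 2 * n) : Cond n (update F (r0, s0) v) r s E := by
  rcases h with ⟨a, b⟩ | ⟨a, b, c⟩
  · refine Or.inl ⟨a, fun r' hr s' => ?_⟩
    rw [update_apply]; split_ifs with hh
    · simp only [Prod.mk.injEq] at hh; exact h1 a (by omega)
    · exact b _ hr _
  · refine Or.inr ⟨a, fun r' => ?_, fun s' hs r' => ?_⟩
    · rw [update_apply]; split_ifs with hh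
      · exact h2 a
      · exact b _
    · rw [update_apply]; split_ifs with hh
      · simp only [Prod.mk.injEq] at hh; exact h3 a (by omega)
      · exact c _ hs _

theorem Ins.sim {sh k F m i v F' f} (h : Ins sh k F m i v F' f) {n r s E}
    (he : F (r, s) = 0) (hF : ∀ s' < s, V sh r s' → 0 < F (r, s'))
    (hb : ∀ c, F c ≤ 2 * n) (hC : Cond n F r s E) (hv : VC n m i v r s E) :
    Cond n F' r s E ∧
    (f ≠ (r, s) → Ins sh k (update F (r, s) E) m i v (update F' (r, s) E) f) ∧
    (f = (r, s) → F' (r, s) < E ∧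
      (¬ (sh = true ∧ r = s) → E % 2 = 0 → ∀ k2 G g, Ins sh k2 F' true (r + 1) E G g →
        Ins sh (k + k2) (update F (r, s) E) m i v G g) ∧
      (sh = true → (r = s ∨ E % 2 = 1) → ∀ k2 G g, Ins sh k2 F' false (s + 1) (prime E) G g →
        Ins sh (k + k2) (update F (r, s) E) m i v G g)) := by
  induction h with
  | @ended F m i v r0 s0 h1 h2 h3 =>
    refine ⟨?_, ?_, ?_⟩
    · apply hC.upd
      · intro hE hr hv2
        cases m
        · have := hv.o rfl; omega
        · have := hv.c1 hE rfl hv2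
          have := (h1.2.1 rfl).1
          omega
      · intro hE; have := (hv.c2 hE).1; omega
      · intro hE hr hv2
        cases m
        · have := (hv.c2 hE).2 rfl hv2
          have := (h1.2.2 rfl).1
          omega
        · have := hv.e rfl; omega
    · intro hne
      rw [update_comm hne]
      refine Ins.ended (h1.plus he) ?_ ?_
      · rw [update_of_ne hne]; exact h2
      · intro s' hs hv'
        have := h3 s' hs hv'
        rw [update_of_ne]; · exact this
        · intro hh; rw [hh] at this; omega
    · intro heq
      obtain ⟨rfl, rfl⟩ := Prod.mk.inj heq
      have hlt : v < E := hv.lt hC.hE (fun hm => (h1.2.1 hm).1) (fun hm => (h1.2.2 hm).1)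
      refine ⟨by simpa using hlt, ?_, ?_⟩
      · intro hd hE k2 G g hI
        rw [add_comm]
        refine Ins.toRow (h1.plus he) (by simpa using hlt) hd (by simpa using hE) ?_
        simpa using hI
      · intro hd hE k2 G g hI
        rw [add_comm]
        refine Ins.toCol (h1.plus he) (by simpa using hlt) hd (by simpa using hE) ?_
        simpa using hI
  | @toRow k F m i v r0 s0 F' f h1 h2 h3 h4 h5 ih =>
    have hne : (r0, s0) ≠ (r, s) := by intro hh; rw [hh] at h2; omega
    have hb0 := hb (r0, s0)
    have hle := hv.pos
    have hC' : Cond n (update F (r0, s0) v) r s E := by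
      apply hC.upd
      · intros; omega
      · intros; omega
      · intro hE _ hv1
        rcases hC with ⟨a, b⟩ | ⟨a, b, c⟩
        · omega
        · exact b (r0, s0) (by omega)
    have hz : VC n true (r0 + 1) (F (r0, s0)) r s E := by
      refine ⟨fun _ => h4, by simp, hb0, by omega, ?_, ?_⟩
      · intro hE _ hz
        rcases hC with ⟨a, b⟩ | ⟨a, b, c⟩
        · by_contra hlt
          exact b r0 (by omega) _ hz
        · omega
      · intro hE
        rcases hC with ⟨a, b⟩ | ⟨a, b, c⟩
        · omega
        · have := b (r0, s0)
          exact ⟨by omega, by simp⟩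
    obtain ⟨i1, i2, i3⟩ := ih (by rw [update_of_ne hne.symm]; exact he)
      (by
        intro s' hs hv'
        rw [update_apply]; split_ifs
        · exact hle
        · exact hF s' hs hv')
      (by
        intro c; rw [update_apply]; split_ifs
        · exact hv.le
        · exact hb c) hC' hz
    rw [update_comm hne] at i2 i3
    have e1 : update F (r, s) E (r0, s0) = F (r0, s0) := update_of_ne hne _ _
    refine ⟨i1, fun hf => ?_, fun hf => ⟨(i3 hf).1, ?_, ?_⟩⟩
    · refine Ins.toRow (h1.plus he) (by rw [e1]; exact h2) h3 (by rw [e1]; exact h4) ?_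
      rw [e1]
      exact i2 hf
    · intro hd hE k2 G g hI
      rw [Nat.add_right_comm]
      refine Ins.toRow (h1.plus he) (by rw [e1]; exact h2) h3 (by rw [e1]; exact h4) ?_
      rw [e1]
      exact (i3 hf).2.1 hd hE k2 G g hI
    · intro hd hE k2 G g hI
      rw [Nat.add_right_comm]
      refine Ins.toRow (h1.plus he) (by rw [e1]; exact h2) h3 (by rw [e1]; exact h4) ?_
      rw [e1]
      exact (i3 hf).2.2 hd hE k2 G g hI
  | @toCol k F m i v r0 s0 F' f h1 h2 h3 h4 h5 ih =>
    have hne : (r0, s0) ≠ (r, s) := by intro hh; rw [hh] at h2; omega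
    have hb0 := hb (r0, s0)
    have hle := hv.pos
    have hC' : Cond n (update F (r0, s0) v) r s E := by
      apply hC.upd
      · intros; omega
      · intros; omega
      · intro hE _ hv1
        rcases hC with ⟨a, b⟩ | ⟨a, b, c⟩
        · omega
        · exact b (r0, s0) (by omega)
    have hp := prime_facts (z := F (r0, s0)) (by omega)
    have hz : VC n false (s0 + 1) (prime (F (r0, s0))) r s E := by
      refine ⟨by simp, fun _ => hp.1, by omega, by omega, by simp, ?_⟩
      · intro hE
        rcases hC with ⟨a, b⟩ | ⟨a, b, c⟩
        · omega
        · have := b (r0, s0)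
          refine ⟨by omega, fun _ hz => ?_⟩
          by_contra hlt
          exact c s0 (by omega) r0 (by omega)
    obtain ⟨i1, i2, i3⟩ := ih (by rw [update_of_ne hne.symm]; exact he)
      (by
        intro s' hs hv'
        rw [update_apply]; split_ifs
        · exact hle
        · exact hF s' hs hv')
      (by
        intro c; rw [update_apply]; split_ifs
        · exact hv.le
        · exact hb c) hC' hz
    rw [update_comm hne] at i2 i3
    have e1 : update F (r, s) E (r0, s0) = F (r0, s0) := update_of_ne hne _ _
    refine ⟨i1, fun hf => ?_, fun hf => ⟨(i3 hf).1, ?_, ?_⟩⟩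
    · refine Ins.toCol (h1.plus he) (by rw [e1]; exact h2) h3 (by rw [e1]; exact h4) ?_
      rw [e1]
      exact i2 hf
    · intro hd hE k2 G g hI
      rw [Nat.add_right_comm]
      refine Ins.toCol (h1.plus he) (by rw [e1]; exact h2) h3 (by rw [e1]; exact h4) ?_
      rw [e1]
      exact (i3 hf).2.1 hd hE k2 G g hI
    · intro hd hE k2 G g hI
      rw [Nat.add_right_comm]
      refine Ins.toCol (h1.plus he) (by rw [e1]; exact h2) h3 (by rw [e1]; exact h4) ?_
      rw [e1]
      exact (i3 hf).2.2 hd hE k2 G g hI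

end RT


namespace RT

open Function

inductive Run (sh : Bool) : List ℕ → (ℕ × ℕ → ℕ) → List (ℕ × ℕ) → Prop
  | nil : Run sh [] (fun _ => 0) []
  | cons {w F cs k y F' f} : Run sh w F cs → Ins sh k F true 0 (2 * y) F' f →
      k ≤ w.length + 1 → Run sh (y :: w) F' (f :: cs)

theorem Run.det {sh w F cs} (h : Run sh w F cs) :
    ∀ {F2 cs2}, Run sh w F2 cs2 → F = F2 ∧ cs = cs2 := by
  induction h with
  | nil => intro F2 cs2 h'; cases h'; exact ⟨rfl, rfl⟩
  | cons h1 h2 h3 ih =>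
    intro F2 cs2 h'
    cases h' with
    | cons g1 g2 g3 =>
      obtain ⟨rfl, rfl⟩ := ih g1
      obtain ⟨rfl, rfl⟩ := h2.det g2
      exact ⟨rfl, rfl⟩

theorem Run.bound {sh w F cs} (h : Run sh w F cs) {n : ℕ} (hw : ∀ x ∈ w, x ≤ n) :
    ∀ c, F c ≤ 2 * n := by
  induction h with
  | nil => simp
  | @cons w F cs k y F' f h1 h2 h3 ih =>
    refine h2.bound (ih fun x hx => hw x (List.mem_cons_of_mem _ hx)) ?_
    have := hw y (by simp)
    omega

structure Inv (sh : Bool) (F : ℕ × ℕ → ℕ) (cs : List (ℕ × ℕ)) : Prop where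
  supp : ∀ c, F c ≠ 0 ↔ c ∈ cs
  good : Good sh cs
  row : ∀ r s s', s ≤ s' → (r, s') ∈ cs → F (r, s) ≤ F (r, s')
  col : ∀ r r' s, r ≤ r' → (r', s) ∈ cs → F (r, s) ≤ F (r', s)
  diag : sh = true → ∀ r, F (r, r) % 2 = 0

theorem Inv.extend {sh F cs r s E gs} (h : Inv sh F cs) (h1 : (r, s) ∉ cs)
    (h2 : Low sh ((r, s) :: cs)) (hg : Good sh gs) (hm : ∀ x, x ∈ gs ↔ x = (r, s) ∨ x ∈ cs)
    (hE : 0 < E) (hF : ∀ c, F c ≤ E) (hd : sh = true → r = s → E % 2 = 0) :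
    Inv sh (update F (r, s) E) gs := by
  have hR := h2.rowEnd h1
  have hC := h2.colEnd h1
  refine ⟨?_, hg, ?_, ?_, ?_⟩
  · intro c
    rw [hm, update_apply]
    split_ifs with hc
    · simp [hc]; omega
    · simp [hc, h.supp]
  · intro a b b' hb hmem
    by_cases e : (a, b') = (r, s)
    · rw [e, update_self, update_apply]; split_ifs
      · exact le_rfl
      · exact hF _
    · have hmem' := ((hm _).1 hmem).resolve_left e
      rw [update_of_ne e, update_of_ne]
      · exact h.row a b b' hb hmem'
      · intro e'
        obtain ⟨rfl, rfl⟩ := Prod.mk.inj e'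
        exact h1 (h.good.low.left' hmem' hb hR.1)
  · intro a a' b hb hmem
    by_cases e : (a', b) = (r, s)
    · rw [e, update_self, update_apply]; split_ifs
      · exact le_rfl
      · exact hF _
    · have hmem' := ((hm _).1 hmem).resolve_left e
      rw [update_of_ne e, update_of_ne]
      · exact h.col a a' b hb hmem'
      · intro e'
        obtain ⟨rfl, rfl⟩ := Prod.mk.inj e'
        exact h1 (h.good.low.up' hmem' hb)
  · intro hs a
    rw [update_apply]; split_ifs with e
    · simp only [Prod.mk.injEq] at e
      exact hd hs (by omega)
    · exact h.diag hs a

theorem exists_rowEnd (sh : Bool) (S : List (ℕ × ℕ)) (r : ℕ) : ∃ s, RowEnd sh S r s := by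
  classical
  have hex : ∃ s, V sh r s ∧ (r, s) ∉ S := by
    have hfin : {s | (r, s) ∈ S}.Finite := by
      have : {s | (r, s) ∈ S} ⊆ ((S.map Prod.snd).toFinset : Set ℕ) := by
        intro s hs
        simp only [List.coe_toFinset, List.mem_map, Set.mem_setOf_eq]
        exact ⟨_, hs, rfl⟩
      exact (Finset.finite_toSet _).subset this
    obtain ⟨s, h1, h2⟩ := (hfin.infinite_compl).exists_gt r
    exact ⟨s, fun _ => h2.le, h1⟩
  refine ⟨Nat.find hex, (Nat.find_spec hex).1, (Nat.find_spec hex).2, fun s' hs hv => ?_⟩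
  have := Nat.find_min hex hs
  by_contra hn
  exact this ⟨hv, hn⟩

theorem exists_colEnd {sh S r s} (hS : Low sh S) (hn : (r, s) ∉ S) (h : Low sh ((r, s) :: S)) :
    ∃ r', ColEnd sh ((r, s) :: S) r' (s + 1) := by
  classical
  have hv : V sh r s := h.valid r s (by simp)
  have h1 : (r, s + 1) ∉ (r, s) :: S := by
    simp only [List.mem_cons, Prod.mk.injEq, not_or]
    exact ⟨by omega, fun hh => hn (hS.left _ _ hh hv)⟩
  have hex : ∃ r', (r', s + 1) ∉ (r, s) :: S := ⟨r, h1⟩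
  refine ⟨Nat.find hex, ?_, Nat.find_spec hex, fun r' hr => ?_⟩
  · intro hh
    have := Nat.find_le (h := hex) h1
    have := hv hh
    omega
  · have := Nat.find_min hex hr
    simpa using this

theorem main_a {sh : Bool} {b : List ℕ} {n M : ℕ} (hn : 1 ≤ n) (hb : ∀ x ∈ b, 1 ≤ x ∧ x ≤ n)
    (hI : ∀ w F cs, w.length < M → (∀ x ∈ w, 1 ≤ x) → Run sh w F cs → Inv sh F cs)
    (a : List ℕ) (ha : ∀ x ∈ a, 1 ≤ x ∧ x < n) (hM : (a ++ b).length < M) :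
    ∀ F cs, Run sh (a ++ b) F cs → ∃ r s E gs, Run sh (a ++ n :: b) (update F (r, s) E) gs ∧
      Bump sh a.length cs gs r s (decide (E % 2 = 1)) ∧ Cond n F r s E ∧
      (sh = true → r = s → E % 2 = 0) := by
  induction a with
  | nil =>
    intro F cs hR
    simp only [List.nil_append] at *
    have hinv := hI b F cs hM (fun x hx => (hb x hx).1) hR
    have hbd := hR.bound (n := n) (fun x hx => (hb x hx).2)
    obtain ⟨s, hs⟩ := exists_rowEnd sh cs 0
    have hpos : ∀ s' < s, V sh 0 s' → 0 < F (0, s') := fun s' h1 h2 =>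
      Nat.pos_of_ne_zero ((hinv.supp _).2 (hs.2.2 s' h1 h2))
    have h0 : F (0, s) = 0 := by
      by_contra hh; exact hs.2.1 ((hinv.supp _).1 hh)
    refine ⟨0, s, 2 * n, (0, s) :: cs, Run.cons hR (Ins.ended ?_ h0 hpos) (by omega), ?_, ?_, ?_⟩
    · exact ⟨hs.1, fun _ => ⟨rfl, fun s' h1 h2 => ⟨hpos s' h1 h2, hbd _⟩⟩, by simp⟩
    · have : decide (2 * n % 2 = 1) = false := by simp
      rw [this]
      exact Bump.start hs
    · exact Or.inl ⟨rfl, by simp⟩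
    · intros; omega
  | cons y a ih =>
    intro F' cs' hR'
    have hinv' := hI _ F' cs' hM (by
      intro x hx
      simp only [List.cons_append, List.mem_cons, List.mem_append] at hx
      rcases hx with rfl | hx | hx
      · exact (ha _ (by simp)).1
      · exact (ha x (by simp [hx])).1
      · exact (hb x hx).1) hR'
    have hbd' := hR'.bound (n := n) (by
      intro x hx
      simp only [List.cons_append, List.mem_cons, List.mem_append] at hx
      rcases hx with rfl | hx | hx
      · exact (ha _ (by simp)).2.le
      · exact (ha x (by simp [hx])).2.le
      · exact (hb x hx).2)
    cases hR' with
    | @cons _ F cs k _ _ f hR hIns hk =>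
    have ha' : ∀ x ∈ a, 1 ≤ x ∧ x < n := fun x hx => ha x (by simp [hx])
    have hM' : (a ++ b).length < M := by simp at hM ⊢; omega
    have hinv := hI _ F cs hM' (by
      intro x hx
      rcases List.mem_append.1 hx with hx | hx
      · exact (ha' x hx).1
      · exact (hb x hx).1) hR
    have hbd := hR.bound (n := n) (by
      intro x hx
      rcases List.mem_append.1 hx with hx | hx
      · exact (ha' x hx).2.le
      · exact (hb x hx).2)
    obtain ⟨r, s, E, gs, hRp, hB, hC, hd⟩ := ih ha' hM' F cs hR
    obtain ⟨b1, b2, b3, b4, b5⟩ := hB.facts hinv.good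
    have hre := b3.rowEnd b2
    have hce := b3.colEnd b2
    have hy := ha y (by simp)
    have hvc : VC n true 0 (2 * y) r s E := by
      refine ⟨fun _ => by omega, by simp, by omega, by omega, ?_, ?_⟩
      · intros; omega
      · intro _; exact ⟨by omega, by simp⟩
    obtain ⟨s1, s2, s3⟩ := hIns.sim (r := r) (s := s) (E := E) (n := n)
      (by by_contra hh; exact b2 ((hinv.supp _).1 hh))
      (fun s' h1 h2 => Nat.pos_of_ne_zero ((hinv.supp _).2 (hre.2.2 s' h1 h2))) hbd hC hvc
    have hlen : k ≤ (a ++ n :: b).length := by simp at hk ⊢; omega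
    by_cases hf : f = (r, s)
    · subst hf
      obtain ⟨hlt, c1, c2⟩ := s3 rfl
      by_cases hE : E % 2 = 0 ∧ ¬ (sh = true ∧ r = s)
      · -- bumped unprimed entry goes to next row
        obtain ⟨hE, hd'⟩ := hE
        have hE2 : E = 2 * n := by rcases hC.hE with h | h <;> omega
        obtain ⟨s', hs'⟩ := exists_rowEnd sh ((r, s) :: cs) (r + 1)
        have hpos : ∀ s'' < s', V sh (r + 1) s'' → 0 < F' (r + 1, s'') := fun s'' h1 h2 =>
          Nat.pos_of_ne_zero ((hinv'.supp _).2 (hs'.2.2 s'' h1 h2))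
        have h0 : F' (r + 1, s') = 0 := by
          by_contra hh; exact hs'.2.1 ((hinv'.supp _).1 hh)
        have hi : Ins sh 1 F' true (r + 1) E (update F' (r + 1, s') E) (r + 1, s') :=
          Ins.ended ⟨hs'.1, fun _ => ⟨rfl, fun s'' h1 h2 => ⟨hpos s'' h1 h2, hE2 ▸ hbd' _⟩⟩,
            by simp⟩ h0 hpos
        refine ⟨r + 1, s', E, (r + 1, s') :: gs, Run.cons hRp (c1 hd' hE _ _ _ hi) (Nat.succ_le_succ hlen),
          ?_, ?_, fun _ _ => hE⟩
        · have : decide (E % 2 = 1) = false := by simp [hE]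
          rw [this] at hB ⊢
          exact Bump.row hB hd' hs'
        · refine Or.inl ⟨hE2, fun r' hr s'' hh => ?_⟩
          rcases s1 with ⟨_, t⟩ | ⟨t, _⟩
          · by_cases hr' : r' < r
            · exact t r' hr' _ hh
            · obtain rfl : r' = r := by omega
              have hm : (r', s'') ∈ (r', s) :: cs := (hinv'.supp _).1 (by omega)
              have hle : s'' ≤ s := by
                by_contra hgt
                rcases List.mem_cons.1 hm with hm | hm
                · simp only [Prod.mk.injEq] at hm; omega
                · exact b2 (hinv.good.low.left' hm (by omega) hre.1)
              have := hinv'.row r' s'' s hle (by simp)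
              omega
          · omega
      · have hsh : sh = true := by
          rcases hC.hE with h | h
          · by_contra hns
            exact hE ⟨by omega, fun k => hns k.1⟩
          · by_contra hns
            have := b5 (by simpa using hns)
            simp at this; omega
        have hE1 : r = s ∨ E % 2 = 1 := by
          by_contra hh
          exact hE ⟨by omega, fun k => hh (Or.inl k.2)⟩
        have hp := prime_facts (z := E) (by omega)
        have hp2 : prime E + 1 = 2 * n := by
          rcases hC.hE with h | h <;> omega
        have hno : ∀ c, F' c ≠ 2 * n := by
          rcases s1 with ⟨t1, t2⟩ | ⟨t1, t2, t3⟩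
          · obtain rfl : r = s := by omega
            rintro ⟨p, q⟩ hh
            by_cases hpr : p < r
            · exact t2 p hpr _ hh
            · have hm : (p, q) ∈ (r, r) :: cs := (hinv'.supp _).1 (by omega)
              rcases List.mem_cons.1 hm with hm | hm
              · rw [hm] at hh; omega
              · have := hinv.good.low.valid p q hm hsh
                exact b2 (hinv.good.low.mem hm (by omega) (by omega) (fun _ => le_rfl))
          · exact t2
        have hno2 : ∀ s' < s + 1, ∀ r', F' (r', s') + 1 ≠ 2 * n := by
          intro q hq p hh
          have hm : (p, q) ∈ (r, s) :: cs := (hinv'.supp _).1 (by omega)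
          have hval := b3.valid p q hm hsh
          rcases s1 with ⟨t1, t2⟩ | ⟨t1, t2, t3⟩
          · obtain rfl : r = s := by omega
            have m1 : (p, r) ∈ (r, r) :: cs := b3.up' (r := r) (by simp) (by omega)
            have l1 := hinv'.row p q r (by omega) m1
            have l2 := hinv'.col p r r (by omega) (by simp)
            have := hinv'.diag hsh r
            omega
          · by_cases hqs : q < s
            · exact t3 q hqs p hh
            · obtain rfl : q = s := by omega
              have hle : p ≤ r := by
                by_contra hgt
                rcases List.mem_cons.1 hm with hm | hm
                · simp only [Prod.mk.injEq] at hm; omega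
                · exact b2 (hinv.good.low.up' hm (by omega))
              have := hinv'.col p r q hle (by simp)
              omega
        obtain ⟨r', hr'⟩ := exists_colEnd hinv.good.low b2 b3
        obtain ⟨hle, hL'⟩ := colBump_corner hinv.good.low b2 b3 hr'
        have hre' := hL'.rowEnd hr'.2.1
        have hpos : ∀ s'' < s + 1, V sh r' s'' → 0 < F' (r', s'') := fun s'' h1 h2 =>
          Nat.pos_of_ne_zero ((hinv'.supp _).2 (hre'.2.2 s'' h1 h2))
        have h0 : F' (r', s + 1) = 0 := by
          by_contra hh; exact hr'.2.1 ((hinv'.supp _).1 hh)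
        have hi : Ins sh 1 F' false (s + 1) (prime E) (update F' (r', s + 1) (prime E))
            (r', s + 1) := by
          refine Ins.ended ⟨hr'.1, by simp, fun _ => ⟨rfl, fun r'' h1 => ⟨?_, ?_⟩⟩⟩ h0 hpos
          · exact Nat.pos_of_ne_zero ((hinv'.supp _).2 (hr'.2.2 r'' h1))
          · have := hbd' (r'', s + 1)
            have := hno (r'', s + 1)
            omega
        refine ⟨r', s + 1, prime E, (r', s + 1) :: gs,
          Run.cons hRp (c2 hsh hE1 _ _ _ hi) (Nat.succ_le_succ hlen), ?_, ?_, ?_⟩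
        · have : decide (prime E % 2 = 1) = true := by simp [hp.1]
          rw [this]
          exact Bump.col hB hsh (by rcases hE1 with h | h <;> simp [h]) hr'
        · exact Or.inr ⟨hp2, hno, hno2⟩
        · intro _ hh
          have := hre.1 hsh
          omega
    · exact ⟨r, s, E, f :: gs, Run.cons hRp (s2 hf) (Nat.le_succ_of_le hlen), Bump.same hB hf, s1, hd⟩

theorem run_exists (sh : Bool) : ∀ M, ∀ w : List ℕ, w.length = M → (∀ x ∈ w, 1 ≤ x) →
    ∃ F cs, Run sh w F cs ∧ Inv sh F cs := by
  intro M
  induction M using Nat.strong_induction_on with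
  | _ M ih =>
  intro w hw hpos
  by_cases h0 : w = []
  · subst h0
    exact ⟨_, _, Run.nil, by simp, trivial, by simp, by simp, by simp⟩
  obtain ⟨a, n, b, rfl, h1, h2⟩ := max_split w h0
  have hI : ∀ w F cs, w.length < M → (∀ x ∈ w, 1 ≤ x) → Run sh w F cs → Inv sh F cs := by
    intro w F cs hl hp hR
    obtain ⟨F2, cs2, g1, g2⟩ := ih _ hl w rfl hp
    obtain ⟨rfl, rfl⟩ := hR.det g1
    exact g2
  have hl : (a ++ b).length < M := by simp at hw ⊢; omega
  have hp2 : ∀ x ∈ a ++ b, 1 ≤ x := by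
    intro x hx; apply hpos
    rcases List.mem_append.1 hx with hx | hx <;> simp [hx]
  obtain ⟨F, cs, hR, hinv⟩ := ih _ hl (a ++ b) rfl hp2
  have hn : 1 ≤ n := hpos n (by simp)
  obtain ⟨r, s, E, gs, g1, g2, g3, g4⟩ := main_a hn
    (fun x hx => ⟨hpos x (by simp [hx]), h2 x hx⟩) hI a
    (fun x hx => ⟨hpos x (by simp [hx]), h1 x hx⟩) hl F cs hR
  obtain ⟨b1, b2, b3, b4, b5⟩ := g2.facts hinv.good
  refine ⟨_, gs, g1, hinv.extend b2 b3 b1 b4 ?_ ?_ g4⟩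
  · rcases g3.hE with h | h <;> omega
  · have hbd := hR.bound (n := n) (by
      intro x hx
      rcases List.mem_append.1 hx with hx | hx
      · exact (h1 x hx).le
      · exact h2 x hx)
    intro c
    have := hbd c
    rcases g3 with ⟨h, _⟩ | ⟨h, h', _⟩
    · omega
    · have := h' c
      omega

theorem run_inv {sh w F cs} (hw : ∀ x ∈ w, 1 ≤ x) (h : Run sh w F cs) : Inv sh F cs := by
  obtain ⟨F2, cs2, g1, g2⟩ := run_exists sh _ w rfl hw
  obtain ⟨rfl, rfl⟩ := h.det g1
  exact g2

theorem Run.length {sh w F cs} (h : Run sh w F cs) : cs.length = w.length := by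
  induction h with
  | nil => rfl
  | cons h1 h2 h3 ih => simp [ih]

/-- abstract form of the main theorem -/
theorem run_delta {sh : Bool} (cells : List ℕ → List (ℕ × ℕ))
    (hlen : ∀ w, (cells w).length = w.length)
    (hc : ∀ w F cs, (∀ x ∈ w, 1 ≤ x) → Run sh w F cs → cells w = cs)
    (u : List ℕ) (x : ℕ) (hu : ∀ y ∈ u ++ [x], 1 ≤ y) :
    Good sh (cells u) ∧ Good sh (cells (u ++ [x])) ∧
    deltaOp (u.length + 1) (fill (cells (u ++ [x]))) = fill (cells u) := by
  have hG : ∀ w, (∀ x ∈ w, 1 ≤ x) → Good sh (cells w) := by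
    intro w hw
    obtain ⟨F, cs, g1, g2⟩ := run_exists sh _ w rfl hw
    rw [hc w F cs hw g1]; exact g2.good
  have hD : ∀ a n b, (∀ x ∈ a ++ n :: b, 1 ≤ x) → (∀ x ∈ a, x < n) → (∀ x ∈ b, x ≤ n) →
      ∃ r s t, Bump sh a.length (cells (a ++ b)) (cells (a ++ n :: b)) r s t := by
    intro a n b hpos h1 h2
    have hp2 : ∀ x ∈ a ++ b, 1 ≤ x := by
      intro x hx; apply hpos
      rcases List.mem_append.1 hx with hx | hx <;> simp [hx]
    obtain ⟨F, cs, g1, g2⟩ := run_exists sh _ (a ++ b) rfl hp2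
    obtain ⟨r, s, E, gs, k1, k2, k3, k4⟩ := main_a (hpos n (by simp))
      (fun x hx => ⟨hpos x (by simp [hx]), h2 x hx⟩)
      (M := (a ++ b).length + 1) (fun w F cs _ hw h => run_inv hw h) a
      (fun x hx => ⟨hpos x (by simp [hx]), h1 x hx⟩) (by omega) F cs g1
    rw [hc _ _ _ hp2 g1, hc _ _ _ hpos k1]
    exact ⟨_, _, _, k2⟩
  obtain ⟨r, s, hJ⟩ := jdt_cells cells hlen hG hD u.length u x rfl hu
  have g1 : Good sh (cells u) := hG u (fun y hy => hu y (by simp [hy]))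
  have g2 := hG (u ++ [x]) hu
  have := delta_fill hJ g1 g2
  rw [hlen] at this
  exact ⟨g1, g2, by simpa using this⟩

end RT


namespace RT

open Function

structure Rep (T : List (List ℕ)) (F : ℕ × ℕ → ℕ) : Prop where
  val : ∀ r s, r ≤ s → F (r, s) = (rows T r).getD (s - r) 0
  pos : ∀ r j, j < (rows T r).length → (rows T r).getD j 0 ≠ 0

theorem getD_zero_of_le {l : List ℕ} {j : ℕ} (h : l.length ≤ j) : l.getD j 0 = 0 := by
  simp [List.getD_eq_getElem?_getD, List.getElem?_eq_none h]

theorem Rep.lt_iff {T F r s} (h : Rep T F) (hrs : r ≤ s) :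
    s - r < (rows T r).length ↔ 0 < F (r, s) := by
  rw [h.val r s hrs]
  constructor
  · intro h1; exact Nat.pos_of_ne_zero (h.pos _ _ h1)
  · intro h1
    by_contra h2
    rw [getD_zero_of_le (by omega)] at h1
    omega

theorem length_padSet {l : List ℕ} {j v : ℕ} (h : j ≤ l.length) :
    (padSet l j v).length = if j < l.length then l.length else l.length + 1 := by
  unfold padSet
  split_ifs
  · simp
  · simp; omega

theorem Rep.upd {T T' F r s v} (h : Rep T F) (hrs : r ≤ s) (hl : s - r ≤ (rows T r).length)
    (hv : 0 < v)
    (hT : ∀ r', rows T' r' = if r' = r then padSet (rows T r) (s - r) v else rows T r') :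
    Rep T' (update F (r, s) v) := by
  constructor
  · intro a b hab
    rw [hT, update_apply]
    by_cases ha : a = r
    · subst ha
      rw [if_pos rfl, padSet_getD]
      by_cases hb : b = s
      · subst hb; simp
      · rw [if_neg (by simpa using hb), if_neg (by omega), h.val a b hab]
    · rw [if_neg ha, if_neg (by simp [ha]), h.val a b hab]
  · intro a j
    rw [hT]
    by_cases ha : a = r
    · subst ha
      rw [if_pos rfl, padSet_getD, length_padSet hl]
      intro hj
      split_ifs with h1
      · omega
      · apply h.pos
        split_ifs at hj <;> omega
    · rw [if_neg ha]; exact h.pos a j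

theorem rows_set (T : List (List ℕ)) (r j v : ℕ) (hj : j < (rows T r).length) (r' : ℕ) :
    rows (T.set r ((rows T r).set j v)) r' =
      if r' = r then padSet (rows T r) j v else rows T r' := by
  have hr : r < T.length := by
    by_contra hh
    have : rows T r = [] := by
      simp [rows, List.getD_eq_getElem?_getD, List.getElem?_eq_none (not_lt.1 hh)]
    rw [this] at hj; simp at hj
  unfold padSet
  rw [if_pos hj]
  by_cases h : r' = r
  · subst h
    simp [rows, List.getD_eq_getElem?_getD, hr]
  · simp only [rows, List.getD_eq_getElem?_getD, List.getElem?_set, Ne.symm h, h, if_false]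

theorem tsize_same {T T' : List (List ℕ)}
    (h1 : ∀ r, (rows T' r).length = (rows T r).length) : tsize T' = tsize T := by
  rw [tsize_eq T (T.length + T'.length) (by omega), tsize_eq T' (T.length + T'.length) (by omega)]
  exact Finset.sum_congr rfl (fun r _ => h1 r)

theorem tsize_upd {T T' : List (List ℕ)} {r j v : ℕ}
    (hT : ∀ r', rows T' r' = if r' = r then padSet (rows T r) j v else rows T r') :
    (j < (rows T r).length → tsize T' = tsize T) ∧
    (j = (rows T r).length → tsize T' = tsize T + 1) := by
  constructor
  · intro hj
    apply tsize_same
    intro r'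
    rw [hT]; split_ifs with h
    · subst h; rw [length_padSet hj.le, if_pos hj]
    · rfl
  · intro hj
    apply tsize_succ r
    · intro r' h; rw [hT, if_neg h]
    · rw [hT, if_pos rfl, length_padSet hj.le, if_neg (by omega)]

theorem findIdx_none {l : List ℕ} {v : ℕ} (h : ∀ j < l.length, l.getD j 0 ≤ v) :
    l.findIdx? (fun z => decide (v < z)) = none := by
  rw [List.findIdx?_eq_none_iff]
  intro x hx
  obtain ⟨j, hj, rfl⟩ := List.getElem_of_mem hx
  have := h j hj
  simp [List.getD_eq_getElem?_getD, hj] at this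
  simpa using this

theorem findIdx_some {l : List ℕ} {v j : ℕ} (hj : j < l.length) (hv : v < l.getD j 0)
    (h : ∀ i < j, l.getD i 0 ≤ v) :
    l.findIdx? (fun z => decide (v < z)) = some j := by
  rw [List.findIdx?_eq_some_iff_getElem]
  refine ⟨hj, ?_, ?_⟩
  · simp [List.getD_eq_getElem?_getD, hj] at hv
    simpa using hv
  · intro i hi
    have := h i hi
    simp [List.getD_eq_getElem?_getD, (by omega : i < l.length)] at this
    simpa using this

theorem find_range_none {c : ℕ} {p : ℕ → Bool} (h : ∀ r ≤ c, p r = false) :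
    (List.range (c + 1)).find? p = none := by
  rw [List.find?_eq_none]
  intro x hx
  rw [h x (by simp at hx; omega)]; simp

theorem find_range_some {c r : ℕ} {p : ℕ → Bool} (hr : r ≤ c) (hp : p r = true)
    (h : ∀ r' < r, p r' = false) :
    (List.range (c + 1)).find? p = some r := by
  rw [List.find?_range_eq_some]
  refine ⟨hp, by simp; omega, fun j hj => by simp [h j hj]⟩

theorem findIdx_range {c r : ℕ} {p : ℕ → Bool} (hr : r ≤ c) (hp : p r = true)
    (h : ∀ r' < r, p r' = false) :
    (List.range (c + 1)).findIdx p = r := by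
  rw [List.findIdx_eq (by simp; omega)]
  refine ⟨by simpa using hp, fun j hj => by simpa using h j hj⟩

theorem Ins.link {k F m i v F' f} (h : Ins true k F m i v F' f) : ∀ fuel T, k ≤ fuel → 0 < v →
    Rep T F → (∀ r s, 0 < F (r + 1, s) → r + 1 ≤ s → 0 < F (r, s)) →
    Rep (mixedIns fuel T m i v).1 F' ∧ (mixedIns fuel T m i v).2 = f ∧
    tsize (mixedIns fuel T m i v).1 = tsize T + 1 := by
  induction h with
  | @ended F m i v r s h1 h2 h3 =>
    intro fuel T hf hv hR hup
    obtain ⟨fuel, rfl⟩ : ∃ q, fuel = q + 1 := ⟨fuel - 1, by omega⟩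
    have hrs : r ≤ s := h1.1 rfl
    have hlen : s - r = (rows T r).length := by
      have a1 := (hR.lt_iff hrs).not.2 (by omega)
      by_contra hne
      have hv' : r ≤ r + (rows T r).length := by omega
      have a2 := (hR.lt_iff hv').2 (h3 _ (by omega) (fun _ => hv'))
      omega
    have hT := rows_setBox T r (s - r) v
    have key : mixedIns (fuel + 1) T m i v = (setBox T r (s - r) v, (r, s)) := by
      cases m
      · obtain ⟨rfl, g⟩ := h1.2.2 rfl
        have hzero : ∀ d, r + d ≤ s → F (r + d, s) = 0 := by
          intro d
          induction d with
          | zero => intro _; exact h2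
          | succ d ihd =>
            intro hd
            have := ihd (by omega)
            by_contra hh
            have := hup (r + d) s (by rw [← add_assoc] at hh; omega) (by omega)
            omega
        rw [mixedIns]
        rw [find_range_none, findIdx_range hrs]
        · simpa [rows] using hlen.symm.le
        · intro r' hr
          have := (hR.lt_iff (by omega : r' ≤ s)).2 (g r' hr).1
          simpa [rows] using this
        · intro r' hr
          by_cases hr' : r' < r
          · have := (g r' hr').2
            rw [hR.val _ _ hr] at this
            simp only [rows] at this
            simp only [sEntry, Bool.and_eq_false_iff, decide_eq_false_iff_not]
            right; exact decide_eq_false (not_lt.2 this)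
          · have := hzero (r' - r) (by omega)
            rw [show r + (r' - r) = r' by omega] at this
            have := (hR.lt_iff hr).not.2 (by omega)
            simp only [rows] at this
            simp only [Bool.and_eq_false_iff, decide_eq_false_iff_not]
            left; exact this
      · obtain ⟨rfl, g⟩ := h1.2.1 rfl
        rw [mixedIns]
        have : List.findIdx? (fun z => decide (v < z)) (T.getD r []) = none := by
          apply findIdx_none
          intro j hj
          have := (g (r + j) (by simp only [rows] at hlen; omega) (fun _ => by omega)).2
          rw [hR.val _ _ (by omega)] at this
          simpa [rows] using this
        simp only [this]
        simp only [rows] at hlen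
        rw [← hlen]
        simp; omega
    rw [key]
    exact ⟨hR.upd hrs hlen.le hv hT, rfl, (tsize_upd hT).2 hlen⟩
  | @toRow k F m i v r s F' f h1 h2 h3 h4 h5 ih =>
    intro fuel T hf hv hR hup
    obtain ⟨fuel, rfl⟩ : ∃ q, fuel = q + 1 := ⟨fuel - 1, by omega⟩
    have hrs : r ≤ s := h1.1 rfl
    have hlen := (hR.lt_iff hrs).2 (by omega)
    have hval := hR.val r s hrs
    have hne : r ≠ s := fun e => h3 ⟨rfl, e⟩
    have hup' : ∀ a b, 0 < update F (r, s) v (a + 1, b) → a + 1 ≤ b →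
        0 < update F (r, s) v (a, b) := by
      intro a b ha hb
      rw [update_apply] at ha ⊢
      split_ifs with e1
      · exact hv
      · apply hup a b _ hb
        split_ifs at ha with e2
        · rw [e2]; omega
        · exact ha
    have key : ∃ T', (∀ r', rows T' r' =
        if r' = r then padSet (rows T r) (s - r) v else rows T r') ∧
        mixedIns (fuel + 1) T m i v = mixedIns fuel T' true (r + 1) (F (r, s)) := by
      cases m
      · obtain ⟨rfl, g⟩ := h1.2.2 rfl
        refine ⟨_, rows_setBox T r (s - r) v, ?_⟩
        rw [mixedIns, find_range_some hrs]
        · have : sEntry T r s = F (r, s) := by rw [hval]; rfl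
          simp only [this]
          rw [if_neg (c := r = s ∧ _) (fun hh => hne hh.1), if_pos h4]
        · simp only [sEntry, Bool.and_eq_true, decide_eq_true_eq]
          simp only [rows] at hlen hval
          exact ⟨hlen, decide_eq_true (lt_of_lt_of_eq h2 hval)⟩
        · intro r' hr
          have := (g r' hr).2
          rw [hR.val _ _ (by omega)] at this
          simp only [rows] at this
          simp only [sEntry, Bool.and_eq_false_iff, decide_eq_false_iff_not]
          right; exact decide_eq_false (not_lt.2 this)
      · obtain ⟨rfl, g⟩ := h1.2.1 rfl
        refine ⟨_, rows_set T r (s - r) v hlen, ?_⟩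
        rw [mixedIns]
        have : List.findIdx? (fun z => decide (v < z)) (T.getD r []) = some (s - r) := by
          apply findIdx_some hlen
          · exact lt_of_lt_of_eq h2 hval
          · intro j hj
            have := (g (r + j) (by omega) (fun _ => by omega)).2
            rw [hR.val _ _ (by omega)] at this
            simpa [rows] using this
        simp only [this]
        simp only [rows] at hval
        rw [← hval]
        rw [if_neg (c := s - r = 0 ∧ _) (fun hh => hne (by omega)), if_pos h4]
        rfl
    obtain ⟨T', hT, key⟩ := key
    rw [key]
    have := ih fuel T' (by omega) (by omega) (hR.upd hrs hlen.le hv hT) hup'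
    rw [(tsize_upd hT).1 hlen] at this
    exact this
  | @toCol k F m i v r s F' f h1 h2 h3 h4 h5 ih =>
    intro fuel T hf hv hR hup
    obtain ⟨fuel, rfl⟩ : ∃ q, fuel = q + 1 := ⟨fuel - 1, by omega⟩
    have hrs : r ≤ s := h1.1 rfl
    have hlen := (hR.lt_iff hrs).2 (by omega)
    have hval := hR.val r s hrs
    have hup' : ∀ a b, 0 < update F (r, s) v (a + 1, b) → a + 1 ≤ b →
        0 < update F (r, s) v (a, b) := by
      intro a b ha hb
      rw [update_apply] at ha ⊢
      split_ifs with e1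
      · exact hv
      · apply hup a b _ hb
        split_ifs at ha with e2
        · rw [e2]; omega
        · exact ha
    have hp := prime_facts (z := F (r, s)) (by omega)
    have hpp : (if r = s ∧ F (r, s) % 2 = 0 then F (r, s) - 1 else F (r, s)) = prime (F (r, s)) := by
      unfold prime
      by_cases hz : F (r, s) % 2 = 0
      · have : r = s := by omega
        simp [this]
      · simp [hz]
    have hpo : ¬ prime (F (r, s)) % 2 = 0 := by omega
    have key : ∃ T', (∀ r', rows T' r' =
        if r' = r then padSet (rows T r) (s - r) v else rows T r') ∧
        mixedIns (fuel + 1) T m i v = mixedIns fuel T' false (s + 1) (prime (F (r, s))) := by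
      cases m
      · obtain ⟨rfl, g⟩ := h1.2.2 rfl
        refine ⟨_, rows_setBox T r (s - r) v, ?_⟩
        rw [mixedIns, find_range_some hrs]
        · have : sEntry T r s = F (r, s) := by rw [hval]; rfl
          simp only [this, hpp]
          rw [if_neg hpo]
        · simp only [sEntry, Bool.and_eq_true, decide_eq_true_eq]
          simp only [rows] at hlen hval
          exact ⟨hlen, decide_eq_true (lt_of_lt_of_eq h2 hval)⟩
        · intro r' hr
          have := (g r' hr).2
          rw [hR.val _ _ (by omega)] at this
          simp only [rows] at this
          simp only [sEntry, Bool.and_eq_false_iff, decide_eq_false_iff_not]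
          right; exact decide_eq_false (not_lt.2 this)
      · obtain ⟨rfl, g⟩ := h1.2.1 rfl
        refine ⟨_, rows_set T r (s - r) v hlen, ?_⟩
        rw [mixedIns]
        have : List.findIdx? (fun z => decide (v < z)) (T.getD r []) = some (s - r) := by
          apply findIdx_some hlen
          · exact lt_of_lt_of_eq h2 hval
          · intro j hj
            have := (g (r + j) (by omega) (fun _ => by omega)).2
            rw [hR.val _ _ (by omega)] at this
            simpa [rows] using this
        simp only [this]
        simp only [rows] at hval
        rw [← hval]
        have e : s - r = 0 ↔ r = s := by omega
        simp only [e, hpp]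
        rw [if_neg hpo, show r + (s - r) + 1 = s + 1 by omega]
        rfl
    obtain ⟨T', hT, key⟩ := key
    rw [key]
    have := ih fuel T' (by omega) (by omega) (hR.upd hrs hlen.le hv hT) hup'
    rw [(tsize_upd hT).1 hlen] at this
    exact this

/-! mixed insertion of reversed words -/

def mixP : List ℕ → List (List ℕ)
  | [] => []
  | y :: w => (mixedInsLetter (mixP w) y).1

def mixCells : List ℕ → List (ℕ × ℕ)
  | [] => []
  | y :: w => (mixedInsLetter (mixP w) y).2 :: mixCells w

theorem mixCells_length (w : List ℕ) : (mixCells w).length = w.length := by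
  induction w with
  | nil => rfl
  | cons y w ih => simp [mixCells, ih]

theorem mixedPQ_eq (w : List ℕ) :
    mixedPQ w = (mixP w.reverse, Qr true (mixCells w.reverse)) := by
  induction w using List.reverseRecOn with
  | nil => rfl
  | append_singleton w x ih =>
    unfold mixedPQ at ih ⊢
    rw [List.foldl_append, ih]
    simp [mixP, mixCells, Qr, off]

theorem mix_run {w F cs} (h : Run true w F cs) (hw : ∀ x ∈ w, 1 ≤ x) :
    Rep (mixP w) F ∧ mixCells w = cs ∧ tsize (mixP w) = w.length := by
  induction h with
  | nil => exact ⟨⟨by simp [mixP, rows], by simp [mixP, rows]⟩, rfl, rfl⟩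
  | @cons w F cs k y F' f h1 h2 h3 ih =>
    have hw' : ∀ x ∈ w, 1 ≤ x := fun x hx => hw x (by simp [hx])
    obtain ⟨i1, i2, i3⟩ := ih hw'
    have hinv := run_inv hw' h1
    have hy := hw y (by simp)
    obtain ⟨g1, g2, g3⟩ := h2.link (tsize (mixP w) + 2) (mixP w) (by omega) (by omega) i1 (by
      intro r s hr _
      have := hinv.good.low.up _ _ ((hinv.supp _).1 hr.ne')
      exact Nat.pos_of_ne_zero ((hinv.supp _).2 this))
    refine ⟨g1, ?_, ?_⟩
    · rw [mixCells, i2, mixedInsLetter, g2]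
    · rw [mixP, mixedInsLetter, g3, i3]; simp

end RT


namespace RT

open Function

/-- the rows `i, i + 1, …` of `F` are the doubled rows of `T` -/
structure Rep2 (T : List (List ℕ)) (i : ℕ) (F : ℕ × ℕ → ℕ) : Prop where
  val : ∀ r s, F (i + r, s) = 2 * (rows T r).getD s 0
  pos : ∀ r j, j < (rows T r).length → (rows T r).getD j 0 ≠ 0

theorem Rep2.lt_iff {T i F} (h : Rep2 T i F) (r s : ℕ) :
    s < (rows T r).length ↔ 0 < F (i + r, s) := by
  rw [h.val r s]
  constructor
  · intro h1; have := h.pos _ _ h1; omega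
  · intro h1
    by_contra h2
    rw [getD_zero_of_le (by omega)] at h1
    omega

theorem rows_cons_zero (row : List ℕ) (T : List (List ℕ)) : rows (row :: T) 0 = row := rfl
theorem rows_cons_succ (row : List ℕ) (T : List (List ℕ)) (r : ℕ) :
    rows (row :: T) (r + 1) = rows T r := rfl

theorem Rep2.tail {row T i F} (h : Rep2 (row :: T) i F) {s v : ℕ} :
    Rep2 T (i + 1) (update F (i, s) v) := by
  constructor
  · intro r s'
    rw [update_of_ne (by simp; omega)]
    have := h.val (r + 1) s'
    rw [rows_cons_succ] at this
    rw [← this]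
    congr 2; omega
  · intro r j hj
    exact h.pos (r + 1) j hj

theorem rskInsert_link {k F m i v F' f} (h : Ins false k F m i v F' f) : ∀ x T, m = true →
    v = 2 * x → 0 < x → Rep2 T i F →
    Rep2 (rskInsert x T) i F' ∧ (∀ c : ℕ × ℕ, c.1 < i → F' c = F c) ∧
    ∃ r0, f = (i + r0, (rows T r0).length) ∧
      (∀ r, r ≠ r0 → (rows (rskInsert x T) r).length = (rows T r).length) ∧
      (rows (rskInsert x T) r0).length = (rows T r0).length + 1 := by
  induction h with
  | @ended F m i v r s h1 h2 h3 =>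
    intro x T hm hv hx hR
    obtain ⟨rfl, g⟩ := h1.2.1 hm
    have hs : s = (rows T 0).length := by
      have a1 := (hR.lt_iff 0 s).not.2 (by simp [h2])
      by_contra hne
      have a2 := (hR.lt_iff 0 (rows T 0).length).2 (h3 _ (by omega) (by simp [V]))
      omega
    have key : ∀ a, rows (rskInsert x T) a = if a = 0 then rows T 0 ++ [x] else rows T a := by
      intro a
      cases T with
      | nil =>
        cases a with
        | zero => simp [rskInsert, rows]
        | succ a => simp [rskInsert, rows]
      | cons row T =>
        have : row.findIdx? (fun z => decide (x < z)) = none := by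
          apply findIdx_none
          intro j hj
          have := (g j (by rw [hs]; exact hj) (by simp [V])).2
          have h5 := hR.val 0 j
          rw [rows_cons_zero] at h5
          simp only [add_zero] at h5
          omega
        rw [rskInsert, this]
        cases a with
        | zero => simp [rows]
        | succ a => simp [rows]
    refine ⟨⟨?_, ?_⟩, ?_, 0, ?_, ?_, ?_⟩
    · intro a b
      rw [key]
      cases a with
      | zero =>
        simp only [add_zero, if_true]
        rw [← padSet_length, padSet_getD, update_apply, ← hs]
        by_cases hb : b = s
        · subst hb; simp [hv]
        · rw [if_neg (by simpa using hb), if_neg hb]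
          exact hR.val 0 b
      | succ a =>
        rw [if_neg (by omega), update_of_ne (by simp)]
        exact hR.val _ _
    · intro a j
      rw [key]
      cases a with
      | zero =>
        simp only [if_true]
        rw [← padSet_length, padSet_getD, padSet_length]
        intro hj
        split_ifs with hb
        · omega
        · apply hR.pos
          simp at hj; omega
      | succ a =>
        rw [if_neg (by omega)]
        exact hR.pos _ _
    · rintro ⟨a, b⟩ hc
      rw [update_of_ne]
      simp at hc ⊢; omega
    · simp [hs]
    · intro a ha; rw [key, if_neg ha]
    · rw [key]; simp
  | @toRow k F m i v r s F' f h1 h2 h3 h4 h5 ih =>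
    intro x T hm hv hx hR
    obtain ⟨rfl, g⟩ := h1.2.1 hm
    have hlen : s < (rows T 0).length := (hR.lt_iff 0 s).2 (by simp; omega)
    cases T with
    | nil => simp [rows] at hlen
    | cons row T =>
      rw [rows_cons_zero] at hlen
      have hval : F (r, s) = 2 * row.getD s 0 := hR.val 0 s
      have hfi : row.findIdx? (fun z => decide (x < z)) = some s := by
        apply findIdx_some hlen
        · omega
        · intro j hj
          have := (g j hj (by simp [V])).2
          have h5 : F (r, j) = 2 * row.getD j 0 := hR.val 0 j
          omega
      have e : rskInsert x (row :: T) = row.set s x :: rskInsert (row.getD s 0) T := by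
        rw [rskInsert, hfi]
      rw [e]
      obtain ⟨i1, i2, r0, i3, i4, i5⟩ := ih (row.getD s 0) T rfl hval (by omega) hR.tail
      refine ⟨⟨?_, ?_⟩, ?_, r0 + 1, ?_, ?_, ?_⟩
      · intro a b
        cases a with
        | zero =>
          rw [rows_cons_zero, add_zero, i2 (r, b) (by simp), update_apply]
          have : row.set s x = padSet row s x := by simp [padSet, hlen]
          rw [this, padSet_getD]
          by_cases hb : b = s
          · subst hb; simp [hv]
          · rw [if_neg (by simpa using hb), if_neg hb]
            exact hR.val 0 b
        | succ a =>
          rw [rows_cons_succ, ← i1.val]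
          congr 2; omega
      · intro a j
        cases a with
        | zero =>
          rw [rows_cons_zero]
          have : row.set s x = padSet row s x := by simp [padSet, hlen]
          rw [this, padSet_getD, ← this]
          intro hj
          split_ifs with hb
          · omega
          · have := hR.pos 0 j
            rw [rows_cons_zero] at this
            apply this
            simpa using hj
        | succ a =>
          rw [rows_cons_succ]
          exact i1.pos _ _
      · rintro ⟨a, b⟩ hc
        rw [i2 _ (by simp at hc ⊢; omega), update_of_ne]
        simp at hc ⊢; omega
      · rw [i3, rows_cons_succ]
        congr 1; omega
      · intro a ha
        cases a with
        | zero => simp [rows_cons_zero]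
        | succ a =>
          rw [rows_cons_succ, rows_cons_succ]
          exact i4 a (by omega)
      · rw [rows_cons_succ, rows_cons_succ]
        exact i5
  | toCol h1 h2 h3 h4 h5 ih => simp at h3

theorem newCell_eq {T T' : List (List ℕ)} {r0 : ℕ}
    (h1 : ∀ r, r ≠ r0 → (rows T' r).length = (rows T r).length)
    (h2 : (rows T' r0).length = (rows T r0).length + 1) :
    newCell T T' = (r0, (rows T r0).length) := by
  have hr : r0 < T'.length := by
    by_contra hh
    have : rows T' r0 = [] := by
      simp [rows, List.getD_eq_getElem?_getD, List.getElem?_eq_none (not_lt.1 hh)]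
    rw [this] at h2; simp at h2
  have : (List.range T'.length).findIdx
      (fun r => decide ((T.getD r []).length ≠ (T'.getD r []).length)) = r0 := by
    rw [List.findIdx_eq (by simpa using hr)]
    refine ⟨?_, fun j hj => ?_⟩
    · simp only [rows] at h2
      rw [List.getElem_range]
      exact decide_eq_true (by omega)
    · have := h1 j (by omega)
      simp only [rows] at this
      rw [List.getElem_range]
      exact decide_eq_false (by omega)
  unfold newCell
  simp only [this]
  rfl

/-! RSK insertion of reversed words -/

def rP : List ℕ → List (List ℕ)
  | [] => []
  | y :: w => rskInsert y (rP w)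

def rCells : List ℕ → List (ℕ × ℕ)
  | [] => []
  | y :: w => newCell (rP w) (rP (y :: w)) :: rCells w

theorem rCells_length (w : List ℕ) : (rCells w).length = w.length := by
  induction w with
  | nil => rfl
  | cons y w ih => simp [rCells, ih]

theorem rskPQ_eq (w : List ℕ) :
    rskPQ w = (rP w.reverse, Qr false (rCells w.reverse)) := by
  induction w using List.reverseRecOn with
  | nil => rfl
  | append_singleton w x ih =>
    unfold rskPQ at ih ⊢
    rw [List.foldl_append, ih]
    simp [rP, rCells, Qr, off]

theorem r_run {w F cs} (h : Run false w F cs) (hw : ∀ x ∈ w, 1 ≤ x) :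
    Rep2 (rP w) 0 F ∧ rCells w = cs := by
  induction h with
  | nil => exact ⟨⟨by simp [rP, rows], by simp [rP, rows]⟩, rfl⟩
  | @cons w F cs k y F' f h1 h2 h3 ih =>
    have hw' : ∀ x ∈ w, 1 ≤ x := fun x hx => hw x (by simp [hx])
    obtain ⟨i1, i2⟩ := ih hw'
    obtain ⟨g1, g2, r0, g3, g4, g5⟩ := rskInsert_link h2 y (rP w) rfl rfl (hw y (by simp)) i1
    refine ⟨g1, ?_⟩
    rw [rCells, i2, rP, newCell_eq g4 g5, g3, zero_add]

end RT

/-- (See Stanley, [A1.2], and Serrano, Lemma 3.9.)  For a word `w = w₁ w₂ ⋯ w_l` over the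
positive integers, let `ŵ = w₂ ⋯ w_l`.  Then `Q(ŵ) = Δ Q(w)` and `Q'(ŵ) = Δ Q'(w)`, where
`Q` and `Q'` are the RSK and shifted mixed insertion recording tableaux. -/
theorem recording_tableau_of_word_with_first_letter_deleted
    (w : List ℕ) (hw : ∀ x ∈ w, 1 ≤ x) :
    toFunStraight (rskQ (w.drop 1)) = deltaOp w.length (toFunStraight (rskQ w)) ∧
    toFunShifted (mixedQ (w.drop 1)) = deltaOp w.length (toFunShifted (mixedQ w)) := by
  cases w with
  | nil =>
    constructor
    · funext c
      simp [deltaOp, jdtSlide, rskQ, rskPQ, toFunStraight]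
    · funext c
      simp [deltaOp, jdtSlide, mixedQ, mixedPQ, toFunShifted]
  | cons x u =>
    have hu : ∀ y ∈ u.reverse ++ [x], 1 ≤ y := by
      intro y hy
      apply hw
      simp only [List.mem_append, List.mem_reverse, List.mem_singleton] at hy
      simp only [List.mem_cons]
      tauto
    constructor
    · obtain ⟨g1, g2, g3⟩ := RT.run_delta (sh := false) RT.rCells RT.rCells_length
        (fun w F cs hw h => (RT.r_run h hw).2) u.reverse x hu
      simp only [List.drop_one, List.tail_cons, rskQ, RT.rskPQ_eq, List.reverse_cons,
        List.length_cons]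
      rw [RT.Qr_straight _ g1, RT.Qr_straight _ g2]
      rw [List.length_reverse] at g3
      exact g3.symm
    · obtain ⟨g1, g2, g3⟩ := RT.run_delta (sh := true) RT.mixCells RT.mixCells_length
        (fun w F cs hw h => (RT.mix_run h hw).2.1) u.reverse x hu
      simp only [List.drop_one, List.tail_cons, mixedQ, RT.mixedPQ_eq, List.reverse_cons,
        List.length_cons]
      rw [RT.Qr_shifted _ g1, RT.Qr_shifted _ g2]
      rw [List.length_reverse] at g3
      exact g3.symm
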